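/- Let h: L → M and g: N → M be morphisms of differential graded Lie algebras over ℂ and (A, m_A) a local Artinian ℂ-algebra with residue field ℂ. Two elements (l₀, n₀, m₀) and (l₁, n₁, m₁) of MC_{(h,g)}(A) (written (l_i, n_i, e^{m_i})) are gauge equivalent under the relation ∼ if and only if they are homotopy equivalent, i.e., if and only if there exists (l̃(t,dt), ñ(t,dt), m̃(t,dt)) ∈ (L[t,dt]^1 ⊗ m_A) × (N[t,dt]^1 ⊗ m_A) × (M[t,dt]^0 ⊗ m_A) with d l̃ + ½[l̃, l̃] = 0, d ñ + ½[ñ, ñ] = 0 and g(ñ) = e^{m̃} * h(l̃) in M[t,dt] ⊗ m_A, whose evaluations at t = 0 and t = 1 are (l₀, n₀, m₀) and (l₁, n₁, m₁) respectively. Consequently Def^∞_{C_{(h,g)}} = MC^∞_{C_{(h,g)}}/homotopy is isomorphic to Def_{(h,g)} = MC_{(h,g)}/∼. -/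

import Mathlib

noncomputable section

open TensorProduct

/-- Raw graded Lie data: a `ℤ`-graded complex vector space with a degree-one
differential and a degree-zero bracket (no axioms). -/
structure GLD where
  V : ℤ → Type
  [grp : ∀ i, AddCommGroup (V i)]
  [mod : ∀ i, Module ℂ (V i)]
  d : ∀ i, V i → V (i + 1)
  br : ∀ i j, V i → V j → V (i + j)

attribute [instance] GLD.grp GLD.mod

namespace GLD

/-- Transport along an equality of degrees. -/
def tr (L : GLD) {i j : ℤ} (h : i = j) (x : L.V i) : L.V j := h ▸ x

/-- The Maurer-Cartan equation in degree one: `dx + ½[x,x] = 0`. -/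
def MC1 (L : GLD) (x : L.V 1) : Prop :=
  L.d 1 x + (2 : ℂ)⁻¹ • L.br 1 1 x x = 0

/-- The adjoint action of a degree-zero element on degree one. -/
def ad01 (L : GLD) (a : L.V 0) (x : L.V 1) : L.V 1 := L.tr (by omega) (L.br 0 1 a x)

/-- The adjoint action of a degree-zero element on degree zero. -/
def ad00 (L : GLD) (a : L.V 0) (x : L.V 0) : L.V 0 := L.tr (by omega) (L.br 0 0 a x)

/-- The gauge action `e^a * x = x + Σ_{n≥0} ad_a^n/(n+1)! ([a,x] - da)`. -/
def gauge (L : GLD) (a : L.V 0) (x : L.V 1) : L.V 1 :=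
  x + ∑ᶠ n : ℕ, (((n+1).factorial : ℂ))⁻¹ •
    (L.ad01 a)^[n] (L.ad01 a x - L.tr (by omega) (L.d 0 a))

/-- Right-nested bracket of a word in two degree-zero letters `x` (true) and `y` (false). -/
def nest (L : GLD) (x y : L.V 0) : List Bool → L.V 0
  | [] => 0
  | [b] => if b then x else y
  | b :: (c :: rest) => L.ad00 (if b then x else y) (L.nest x y (c :: rest))

end GLD

/-- The word `x^{r₁} y^{s₁} ⋯ x^{r_n} y^{s_n}` encoded as a list of booleans. -/
def bchWord (P : List (ℕ × ℕ)) : List Bool :=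
  P.flatMap fun p => List.replicate p.1 true ++ List.replicate p.2 false

open Classical in
/-- The coefficient in Dynkin's formula for the Baker-Campbell-Hausdorff series. -/
def bchCoeff (P : List (ℕ × ℕ)) : ℂ :=
  if P = [] ∨ ¬ (∀ p ∈ P, 0 < p.1 + p.2) then 0 else
    (-1 : ℂ) ^ (P.length - 1) / (P.length : ℂ) *
      ((((P.map fun p => p.1 + p.2).sum : ℕ) : ℂ) *
        (((P.map fun p => (p.1.factorial * p.2.factorial : ℕ)).prod : ℕ) : ℂ))⁻¹

/-- The Baker-Campbell-Hausdorff product on degree-zero elements, via Dynkin's formula. -/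
def GLD.bch (L : GLD) (x y : L.V 0) : L.V 0 :=
  ∑ᶠ P : List (ℕ × ℕ), bchCoeff P • L.nest x y (bchWord P)

/-- Differential graded Lie algebra over `ℂ`. -/
structure DGLA extends GLD where
  d_add : ∀ i (x y : V i), d i (x + y) = d i x + d i y
  d_smul : ∀ i (c : ℂ) (x : V i), d i (c • x) = c • d i x
  br_add_left : ∀ i j (x x' : V i) (y : V j), br i j (x + x') y = br i j x y + br i j x' y
  br_smul_left : ∀ i j (c : ℂ) (x : V i) (y : V j), br i j (c • x) y = c • br i j x y
  br_add_right : ∀ i j (x : V i) (y y' : V j), br i j x (y + y') = br i j x y + br i j x y'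
  br_smul_right : ∀ i j (c : ℂ) (x : V i) (y : V j), br i j x (c • y) = c • br i j x y
  d_sq : ∀ i (x : V i), d (i + 1) (d i x) = 0
  antisym : ∀ i j (x : V i) (y : V j),
    br i j x y = - toGLD.tr (by omega) (((Int.negOnePow (i * j) : ℤˣ) : ℤ) • br j i y x)
  leibniz : ∀ i j (x : V i) (y : V j),
    d (i + j) (br i j x y) =
      toGLD.tr (by omega) (br (i + 1) j (d i x) y) +
        ((Int.negOnePow i : ℤˣ) : ℤ) • toGLD.tr (by omega) (br i (j + 1) x (d j y))
  jacobi : ∀ i j k (x : V i) (y : V j) (z : V k),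
    br i (j + k) x (br j k y z) =
      toGLD.tr (by omega) (br (i + j) k (br i j x y) z) +
        ((Int.negOnePow (i * j) : ℤˣ) : ℤ) • toGLD.tr (by omega) (br j (i + k) y (br i k x z))

namespace DGLA

/-- The differential as a linear map. -/
def dLin (L : DGLA) (i : ℤ) : L.V i →ₗ[ℂ] L.V (i + 1) :=
  { toFun := L.d i, map_add' := L.d_add i, map_smul' := L.d_smul i }

/-- The bracket as a bilinear map. -/
def brLin (L : DGLA) (i j : ℤ) : L.V i →ₗ[ℂ] L.V j →ₗ[ℂ] L.V (i + j) :=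
  LinearMap.mk₂ ℂ (L.br i j) (L.br_add_left i j) (fun c x y => L.br_smul_left i j c x y)
    (L.br_add_right i j) (fun c x y => L.br_smul_right i j c x y)

end DGLA

/-- Morphism of (differential) graded Lie algebras (data-level). -/
structure GLDHom (L M : GLD) where
  f : ∀ i, L.V i → M.V i
  f_add : ∀ i (x y : L.V i), f i (x + y) = f i x + f i y
  f_smul : ∀ i (c : ℂ) (x : L.V i), f i (c • x) = c • f i x
  f_d : ∀ i (x : L.V i), f (i + 1) (L.d i x) = M.d i (f i x)
  f_br : ∀ i j (x : L.V i) (y : L.V j), f (i + j) (L.br i j x y) = M.br i j (f i x) (f j y)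

/-- The components of a morphism as linear maps. -/
def GLDHom.lin {L M : GLD} (h : GLDHom L M) (i : ℤ) : L.V i →ₗ[ℂ] M.V i :=
  { toFun := h.f i, map_add' := h.f_add i, map_smul' := h.f_smul i }

section ArtinBase

variable (A : Type) [CommRing A] [Algebra ℂ A] [IsLocalRing A]

/-- The maximal ideal of a local `ℂ`-algebra. -/
abbrev mA : Ideal A := IsLocalRing.maximalIdeal A

/-- Multiplication of the maximal ideal, as a `ℂ`-bilinear map. -/
def mMul : (mA A) →ₗ[ℂ] (mA A) →ₗ[ℂ] (mA A) :=
  LinearMap.mk₂ ℂ (fun x y => ⟨x.1 * y.1, Ideal.mul_mem_left _ _ y.2⟩)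
    (fun x x' y => by ext; simp [add_mul])
    (fun c x y => by ext; simp [smul_mul_assoc])
    (fun x y y' => by ext; simp [mul_add])
    (fun c x y => by ext; simp [mul_smul_comm])

/-- For a DGLA `L`, the graded Lie data on `L ⊗ m_A`. -/
def DGLA.ten (L : DGLA) : GLD where
  V i := L.V i ⊗[ℂ] (mA A)
  d i := fun x => LinearMap.rTensor (mA A) (L.dLin i) x
  br i j := fun x y =>
    TensorProduct.curry
      ((TensorProduct.map (TensorProduct.lift (L.brLin i j)) (TensorProduct.lift (mMul A)))
        ∘ₗ (TensorProduct.tensorTensorTensorComm ℂ (L.V i) (mA A) (L.V j) (mA A)).toLinearMap)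
      x y

end ArtinBase
namespace GLD

/-- Polynomial differential forms `W[t,dt]`:
in degree `n` an element is `(p, q)` representing `Σᵢ pᵢ tⁱ + Σᵢ qᵢ tⁱ dt`,
with `pᵢ ∈ W^n` and `qᵢ ∈ W^{n-1}`. -/
def tdt (W : GLD) : GLD where
  V n := (ℕ →₀ W.V n) × (ℕ →₀ W.V (n - 1))
  d n x :=
    (x.1.sum fun i v => Finsupp.single i (W.d n v),
      (x.2.sum fun i v => Finsupp.single i (W.tr (by omega) (W.d (n - 1) v))) +
        ((Int.negOnePow n : ℤˣ) : ℤ) •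
          x.1.sum fun i v => Finsupp.single (i - 1) ((i : ℂ) • W.tr (by omega) v))
  br n m x y :=
    (x.1.sum fun i v => y.1.sum fun j w => Finsupp.single (i + j) (W.br n m v w),
      (x.1.sum fun i v => y.2.sum fun j w =>
          Finsupp.single (i + j) (W.tr (by omega) (W.br n (m - 1) v w))) +
        ((Int.negOnePow m : ℤˣ) : ℤ) •
          x.2.sum fun i v => y.1.sum fun j w =>
            Finsupp.single (i + j) (W.tr (by omega) (W.br (n - 1) m v w)))

/-- Evaluation `e_a : W[t,dt] → W` at a point `a ∈ ℂ`. -/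
def evalT (W : GLD) (a : ℂ) (n : ℤ) (x : (W.tdt).V n) : W.V n :=
  x.1.sum fun i v => (a ^ i) • v

/-- The inclusion `W → W[t,dt]` of constant polynomials. -/
def constT (W : GLD) (n : ℤ) (v : W.V n) : (W.tdt).V n :=
  (Finsupp.single 0 v, 0)

/-- The integral operator `∫₀¹ : W[t,dt] → W` of degree `-1`. -/
def int01 (W : GLD) (n : ℤ) (x : (W.tdt).V n) : W.V (n - 1) :=
  x.2.sum fun i v => (((i : ℂ) + 1))⁻¹ • v

/-- The integral operator `∫₀ᵗ`, returning the polynomial primitive of the `dt`-part. -/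
def int0t (W : GLD) (n : ℤ) (x : (W.tdt).V n) : ℕ →₀ W.V (n - 1) :=
  x.2.sum fun i v => Finsupp.single (i + 1) ((((i : ℂ) + 1))⁻¹ • v)

/-- The standard homotopy `K(m(t,dt)) = t∫₀¹ m − ∫₀ᵗ m` on `W[t,dt]`, of degree `-1`. -/
def Ktdt (W : GLD) (n : ℤ) (x : (W.tdt).V n) : (W.tdt).V (n - 1) :=
  (Finsupp.single 1 (W.int01 n x) - W.int0t n x, 0)

/-- A degreewise map between graded objects is a quasi-isomorphism: elementwise,
it induces a bijection on cohomology in every degree. -/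
def IsQuasiIso (L M : GLD) (f : ∀ i, L.V i → M.V i) : Prop :=
  ∀ i : ℤ,
    (∀ x : M.V i, M.d i x = 0 →
      ∃ y : L.V i, L.d i y = 0 ∧ ∃ z : M.V (i - 1), x = f i y + M.tr (by omega) (M.d (i - 1) z)) ∧
    (∀ y : L.V i, L.d i y = 0 →
      (∃ z : M.V (i - 1), f i y = M.tr (by omega) (M.d (i - 1) z)) →
      ∃ w : L.V (i - 1), y = L.tr (by omega) (L.d (i - 1) w))

/-- Extension of a degreewise map to polynomial differential forms, coefficientwise. -/
def tdtMap {W W' : GLD} (f : ∀ i, W.V i → W'.V i) (n : ℤ) (x : (W.tdt).V n) : (W'.tdt).V n :=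
  (x.1.sum fun i v => Finsupp.single i (f n v),
   x.2.sum fun i v => Finsupp.single i (f (n - 1) v))

end GLD

section Pair

variable (L M N : DGLA) (h : GLDHom L.toGLD M.toGLD) (g : GLDHom N.toGLD M.toGLD)
variable (A : Type) [CommRing A] [Algebra ℂ A] [IsLocalRing A]

/-- The space of triples `(x, y, p) ∈ (L¹ ⊗ m_A) × (N¹ ⊗ m_A) × (M⁰ ⊗ m_A)`;
the element `p` stands for the exponential `e^p ∈ exp(M⁰ ⊗ m_A)`. -/
abbrev TripleSp := ((L.ten A).V 1) × ((N.ten A).V 1) × ((M.ten A).V 0)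

/-- Extension `h ⊗ id` of a morphism to coefficients in `m_A`. -/
def hTen (i : ℤ) : (L.ten A).V i → (M.ten A).V i :=
  fun x => LinearMap.rTensor (mA A) (h.lin i) x

/-- Extension `g ⊗ id` of a morphism to coefficients in `m_A`. -/
def gTen (i : ℤ) : (N.ten A).V i → (M.ten A).V i :=
  fun x => LinearMap.rTensor (mA A) (g.lin i) x

/-- The Maurer-Cartan set `MC_{(h,g)}(A)`: triples `(x, y, e^p)` with
`dx + ½[x,x] = 0`, `dy + ½[y,y] = 0` and `g(y) = e^p * h(x)`. -/
def MCset : Set (TripleSp L M N A) :=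
  {w | (L.ten A).MC1 w.1 ∧ (N.ten A).MC1 w.2.1 ∧
    gTen M N g A 1 w.2.1 = (M.ten A).gauge w.2.2 (hTen L M h A 1 w.1)}

/-- The gauge relation on `MC_{(h,g)}(A)`: `(x₁,y₁,e^{p₁}) ∼ (x₂,y₂,e^{p₂})` iff there are
`a ∈ L⁰ ⊗ m_A`, `b ∈ N⁰ ⊗ m_A`, `c ∈ M⁻¹ ⊗ m_A` with `x₂ = e^a * x₁`, `y₂ = e^b * y₁` and
`e^{p₂} = e^{g(b)} e^T e^{p₁} e^{−h(a)}`, where `T = dc + [g(y₁), c]` and the products of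
exponentials are computed by the Baker-Campbell-Hausdorff formula. -/
def gaugeRel (w w' : TripleSp L M N A) : Prop :=
  ∃ (a : (L.ten A).V 0) (b : (N.ten A).V 0) (c : (M.ten A).V (-1)),
    w'.1 = (L.ten A).gauge a w.1 ∧
    w'.2.1 = (N.ten A).gauge b w.2.1 ∧
    w'.2.2 = (M.ten A).bch (gTen M N g A 0 b)
      ((M.ten A).bch
        ((M.ten A).tr (show (-1:ℤ)+1 = 0 by omega) ((M.ten A).d (-1) c) +
          (M.ten A).tr (show (1:ℤ)+(-1) = 0 by omega)
            ((M.ten A).br 1 (-1) (gTen M N g A 1 w.2.1) c))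
        ((M.ten A).bch w.2.2 (- hTen L M h A 0 a)))

end Pair

section S18

variable (L M N : DGLA) (h : GLDHom L.toGLD M.toGLD) (g : GLDHom N.toGLD M.toGLD)
variable (A : Type) [CommRing A] [Algebra ℂ A] [IsLocalRing A] [IsArtinianRing A]

/-- Homotopy equivalence of Maurer-Cartan triples: a path
`(l̃(t,dt), ñ(t,dt), m̃(t,dt))` of Maurer-Cartan elements over `ℂ[t,dt]`
joining the two triples. -/
def htpyRel (w w' : TripleSp L M N A) : Prop :=
  ∃ (lt : ((L.ten A).tdt).V 1) (nt : ((N.ten A).tdt).V 1) (mt : ((M.ten A).tdt).V 0),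
    ((L.ten A).tdt).MC1 lt ∧ ((N.ten A).tdt).MC1 nt ∧
    GLD.tdtMap (gTen M N g A) 1 nt =
      ((M.ten A).tdt).gauge mt (GLD.tdtMap (hTen L M h A) 1 lt) ∧
    (L.ten A).evalT 0 1 lt = w.1 ∧ (N.ten A).evalT 0 1 nt = w.2.1 ∧
    (M.ten A).evalT 0 0 mt = w.2.2 ∧
    (L.ten A).evalT 1 1 lt = w'.1 ∧ (N.ten A).evalT 1 1 nt = w'.2.1 ∧
    (M.ten A).evalT 1 0 mt = w'.2.2

end S18

/-- The exponential of a nilpotent element of a `ℂ`-algebra. -/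
def nexp {R : Type*} [Ring R] [Algebra ℂ R] (a : R) : R :=
  letI : Module ℚ R := Module.compHom R (algebraMap ℚ ℂ)
  IsNilpotent.exp a

/-- The truncated exponential series. -/
def expPoly (K : ℕ) : Polynomial ℂ :=
  ∑ i ∈ Finset.range K, Polynomial.C ((i.factorial : ℂ))⁻¹ * Polynomial.X ^ i

/-- The truncated series of `log (1 + X)`. -/
def logPoly (K : ℕ) : Polynomial ℂ :=
  ∑ n ∈ Finset.range K, Polynomial.C ((-1 : ℂ) ^ n / ((n : ℂ) + 1)) * Polynomial.X ^ (n + 1)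

section Nilpotent

open Polynomial

theorem X_pow_dvd_of_derivative {p : ℂ[X]} {K : ℕ} (h0 : p.coeff 0 = 0)
    (h : X ^ K ∣ derivative p) : X ^ (K + 1) ∣ p := by
  rw [X_pow_dvd_iff] at h ⊢
  intro d hd
  rcases d with _ | d
  · exact h0
  · have := h d (by omega)
    rw [coeff_derivative] at this
    exact (mul_eq_zero.1 this).resolve_right (by exact_mod_cast d.succ_ne_zero)

theorem expPoly_succ_derivative (K : ℕ) : derivative (expPoly (K + 1)) = expPoly K := by
  simp only [expPoly, derivative_sum, derivative_C_mul, derivative_X_pow]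
  rw [Finset.sum_range_succ']
  simp only [Nat.cast_zero, zero_mul, map_zero, mul_zero, add_zero]
  refine Finset.sum_congr rfl fun i _ => ?_
  rw [Nat.add_sub_cancel, ← mul_assoc, ← C_mul, Nat.factorial_succ]
  congr 2
  have : ((i : ℂ) + 1) ≠ 0 := by exact_mod_cast i.succ_ne_zero
  push_cast
  field_simp

theorem expPoly_succ (K : ℕ) :
    expPoly (K + 1) = expPoly K + C ((K.factorial : ℂ))⁻¹ * X ^ K :=
  Finset.sum_range_succ _ _

theorem logPoly_derivative (K : ℕ) : (1 + X) * derivative (logPoly K) = 1 - (-X) ^ K := by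
  have h : derivative (logPoly K) = ∑ n ∈ Finset.range K, (-X : ℂ[X]) ^ n := by
    simp only [logPoly, derivative_sum, derivative_C_mul, derivative_X_pow]
    refine Finset.sum_congr rfl fun i _ => ?_
    have : ((i : ℂ) + 1) ≠ 0 := by exact_mod_cast i.succ_ne_zero
    rw [Nat.add_sub_cancel, ← mul_assoc, ← C_mul, neg_pow (X : ℂ[X])]
    push_cast
    rw [div_mul_cancel₀ _ this]
    simp
  rw [h]
  have := mul_neg_geom_sum (-X : ℂ[X]) K
  rwa [sub_neg_eq_add] at this

theorem X_dvd_logPoly (K : ℕ) : X ∣ logPoly K :=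
  Finset.dvd_sum fun n _ => Dvd.dvd.mul_left (dvd_pow_self _ n.succ_ne_zero) _

theorem X_dvd_expPoly_sub_one (K : ℕ) : X ∣ expPoly (K + 1) - 1 := by
  rw [X_dvd_iff, expPoly]
  simp [coeff_X_pow]

theorem X_dvd_comp {p q : ℂ[X]} {n : ℕ} (hp : X ^ n ∣ p) (hq : X ∣ q) : X ^ n ∣ p.comp q := by
  obtain ⟨r, rfl⟩ := hp
  rw [mul_comp, X_pow_comp]
  exact Dvd.dvd.mul_right (pow_dvd_pow_of_dvd hq n) _

theorem X_pow_dvd_logPoly_comp (K : ℕ) :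
    X ^ (K + 1) ∣ (logPoly (K + 1)).comp (expPoly (K + 1) - 1) - X := by
  apply X_pow_dvd_of_derivative
  · rw [← X_dvd_iff]
    refine dvd_sub ?_ dvd_rfl
    simpa using X_dvd_comp (n := 1) (by simpa using X_dvd_logPoly (K + 1))
      (X_dvd_expPoly_sub_one K)
  · have h1 := congrArg (fun p => p.comp (expPoly (K + 1) - 1)) (logPoly_derivative (K + 1))
    simp only [mul_comp, add_comp, one_comp, X_comp, sub_comp, pow_comp, neg_comp] at h1
    rw [add_sub_cancel] at h1
    have h2 : derivative ((logPoly (K + 1)).comp (expPoly (K + 1) - 1) - X) =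
        -(-(expPoly (K + 1) - 1)) ^ (K + 1)
        - C ((K.factorial : ℂ))⁻¹ * X ^ K *
          (derivative (logPoly (K + 1))).comp (expPoly (K + 1) - 1) := by
      rw [derivative_sub, derivative_comp, derivative_sub, derivative_one, sub_zero, derivative_X,
        expPoly_succ_derivative, eq_sub_of_add_eq (expPoly_succ K).symm, sub_mul, h1]
      ring
    rw [h2]
    refine dvd_sub ?_ ?_
    · rw [dvd_neg]
      refine dvd_trans (pow_dvd_pow _ K.le_succ) (pow_dvd_pow_of_dvd ?_ _)
      rw [dvd_neg]
      exact X_dvd_expPoly_sub_one K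
    · exact Dvd.dvd.mul_right (Dvd.dvd.mul_left dvd_rfl _) _

theorem X_pow_dvd_expPoly_comp (K : ℕ) :
    X ^ (K + 1) ∣ (expPoly (K + 1)).comp (logPoly (K + 1)) - 1 - X := by
  set s := (expPoly (K + 1)).comp (logPoly (K + 1)) - 1 - X with hs
  have hs0 : s.coeff 0 = 0 := by
    rw [← X_dvd_iff]
    refine dvd_sub ?_ dvd_rfl
    have := X_dvd_comp (n := 1) (by simpa using X_dvd_expPoly_sub_one K) (X_dvd_logPoly (K + 1))
    simpa using this
  have h1 : X ^ K ∣ (1 + X) * derivative s - s := by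
    have : (1 + X) * derivative s - s =
        -(C ((K.factorial : ℂ))⁻¹ * X ^ K).comp (logPoly (K + 1)) -
          (expPoly K).comp (logPoly (K + 1)) * (-X) ^ (K + 1) := by
      have e2 : (expPoly (K + 1)).comp (logPoly (K + 1)) =
          (expPoly K).comp (logPoly (K + 1)) +
            (C ((K.factorial : ℂ))⁻¹ * X ^ K).comp (logPoly (K + 1)) := by
        rw [expPoly_succ, add_comp]
      have e1 : derivative s =
          (expPoly K).comp (logPoly (K + 1)) * derivative (logPoly (K + 1)) - 1 := by
        rw [hs]
        simp [derivative_comp, expPoly_succ_derivative, mul_comm]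
      have e3 := logPoly_derivative (K + 1)
      rw [e1, hs, e2]
      linear_combination (expPoly K).comp (logPoly (K + 1)) * e3
    rw [this]
    refine dvd_sub ?_ ?_
    · rw [dvd_neg]
      exact X_dvd_comp (Dvd.dvd.mul_left dvd_rfl _) (X_dvd_logPoly _)
    · rw [neg_pow (X : ℂ[X])]
      exact Dvd.dvd.mul_left (Dvd.dvd.mul_left (pow_dvd_pow _ K.le_succ) _) _
  rw [X_pow_dvd_iff] at h1 ⊢
  intro d
  induction d with
  | zero => intro _; exact hs0
  | succ d ih =>
    intro hd
    have h2 := h1 d (by omega)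
    have h3 := ih (by omega)
    have h4 : (X * derivative s).coeff d = s.coeff d * d := by
      rcases d with _ | d
      · simp
      · rw [coeff_X_mul, coeff_derivative]; push_cast; rfl
    rw [add_mul, one_mul, coeff_sub, coeff_add, h4, h3, coeff_derivative] at h2
    have : s.coeff (d + 1) * ((d : ℂ) + 1) = 0 := by simpa using h2
    exact (mul_eq_zero.1 this).resolve_right (by exact_mod_cast d.succ_ne_zero)

variable {R : Type*} [Ring R] [Algebra ℂ R]

theorem nexp_eq_sum {a : R} {K : ℕ} (h : a ^ K = 0) :
    nexp a = ∑ i ∈ Finset.range K, ((i.factorial : ℂ))⁻¹ • a ^ i := by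
  let : Module ℚ R := Module.compHom R (algebraMap ℚ ℂ)
  have := IsNilpotent.exp_eq_sum h
  rw [nexp, this]
  refine Finset.sum_congr rfl fun i _ => ?_
  rw [← Rat.cast_smul_eq_qsmul ℂ]
  simp

theorem nexp_eq_aeval {a : R} {K : ℕ} (h : a ^ K = 0) : nexp a = aeval a (expPoly K) := by
  rw [nexp_eq_sum h, expPoly, map_sum]
  simp [Algebra.smul_def]

theorem nexp_add_of_commute {a b : R} (h : Commute a b) (ha : IsNilpotent a)
    (hb : IsNilpotent b) : nexp (a + b) = nexp a * nexp b := by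
  let : Module ℚ R := Module.compHom R (algebraMap ℚ ℂ)
  exact IsNilpotent.exp_add_of_commute h ha hb

theorem nexp_zero : nexp (0 : R) = 1 := by
  let : Module ℚ R := Module.compHom R (algebraMap ℚ ℂ)
  exact IsNilpotent.exp_zero

theorem nexp_mul_nexp_neg {a : R} (ha : IsNilpotent a) : nexp a * nexp (-a) = 1 := by
  rw [← nexp_add_of_commute (Commute.refl a).neg_right ha ha.neg, add_neg_cancel, nexp_zero]

theorem nexp_neg_mul_nexp {a : R} (ha : IsNilpotent a) : nexp (-a) * nexp a = 1 := by
  rw [← nexp_add_of_commute (Commute.refl a).neg_left ha.neg ha, neg_add_cancel, nexp_zero]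

theorem aeval_eq_zero_of_X_pow_dvd {a : R} {K : ℕ} (h : a ^ K = 0) {p : ℂ[X]}
    (hp : X ^ K ∣ p) : aeval a p = 0 := by
  obtain ⟨q, rfl⟩ := hp
  simp [h]

theorem aeval_logPoly_nexp {z : R} {K : ℕ} (h : z ^ (K + 1) = 0) :
    aeval (nexp z - 1) (logPoly (K + 1)) = z := by
  have := aeval_eq_zero_of_X_pow_dvd h (X_pow_dvd_logPoly_comp K)
  rw [map_sub, aeval_comp, map_sub, ← nexp_eq_aeval h, map_one, aeval_X, sub_eq_zero] at this
  exact this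

theorem aeval_logPoly_pow {u : R} {K : ℕ} (h : u ^ K = 0) (n : ℕ) :
    aeval u (logPoly n) ^ K = 0 := by
  rw [← map_pow]
  exact aeval_eq_zero_of_X_pow_dvd h (pow_dvd_pow_of_dvd (X_dvd_logPoly n) K)

theorem nexp_aeval_logPoly {u : R} {K : ℕ} (h : u ^ (K + 1) = 0) :
    nexp (aeval u (logPoly (K + 1))) = 1 + u := by
  have := aeval_eq_zero_of_X_pow_dvd h (X_pow_dvd_expPoly_comp K)
  rw [map_sub, map_sub, aeval_comp, ← nexp_eq_aeval (aeval_logPoly_pow h _), map_one, aeval_X,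
    sub_sub, sub_eq_zero] at this
  exact this

theorem nexp_injective {a b : R} (ha : IsNilpotent a) (hb : IsNilpotent b)
    (h : nexp a = nexp b) : a = b := by
  obtain ⟨m, hm⟩ := ha
  obtain ⟨n, hn⟩ := hb
  rw [← aeval_logPoly_nexp (pow_eq_zero_of_le (show m ≤ m + n + 1 by omega) hm), h,
    aeval_logPoly_nexp (pow_eq_zero_of_le (show n ≤ m + n + 1 by omega) hn)]

/-- The inner derivation `[a, ·]` as a linear endomorphism. -/
def adEnd (a : R) : Module.End ℂ R := LinearMap.mulLeft ℂ a - LinearMap.mulRight ℂ a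

@[simp] theorem adEnd_apply (a b : R) : adEnd a b = a * b - b * a := rfl

theorem isNilpotent_mulLeft {a : R} (ha : IsNilpotent a) :
    IsNilpotent (LinearMap.mulLeft ℂ a) :=
  (LinearMap.isNilpotent_mulLeft_iff ℂ a).2 ha

theorem isNilpotent_mulRight {a : R} (ha : IsNilpotent a) :
    IsNilpotent (LinearMap.mulRight ℂ a) :=
  (LinearMap.isNilpotent_mulRight_iff ℂ a).2 ha

theorem isNilpotent_adEnd {a : R} (ha : IsNilpotent a) : IsNilpotent (adEnd a) :=
  (LinearMap.commute_mulLeft_right a a).isNilpotent_sub (isNilpotent_mulLeft ha)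
    (isNilpotent_mulRight ha)

theorem nexp_adEnd {a : R} (ha : IsNilpotent a) (b : R) :
    nexp (adEnd a) b = nexp a * b * nexp (-a) := by
  obtain ⟨n, hn⟩ := ha
  have hr : -LinearMap.mulRight ℂ a = LinearMap.mulRight ℂ (-a) := by ext; simp
  have hc : Commute (LinearMap.mulLeft ℂ a) (LinearMap.mulRight ℂ (-a)) :=
    LinearMap.commute_mulLeft_right a (-a)
  have ha : IsNilpotent a := ⟨n, hn⟩
  rw [adEnd, sub_eq_add_neg, hr, nexp_add_of_commute hc (isNilpotent_mulLeft ha)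
    (isNilpotent_mulRight ha.neg), Module.End.mul_apply]
  have hn' : (-a) ^ n = 0 := by rw [neg_pow, hn, mul_zero]
  rw [nexp_eq_sum (a := LinearMap.mulLeft ℂ a) (K := n)
      (by rw [LinearMap.pow_mulLeft, hn, LinearMap.mulLeft_zero_eq_zero]),
    nexp_eq_sum (a := LinearMap.mulRight ℂ (-a)) (K := n)
      (by rw [LinearMap.pow_mulRight, hn', LinearMap.mulRight_zero_eq_zero]),
    nexp_eq_sum hn, nexp_eq_sum hn']
  simp [LinearMap.sum_apply, LinearMap.pow_mulLeft, LinearMap.pow_mulRight, Finset.mul_sum,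
    Finset.sum_mul, mul_assoc]

end Nilpotent

section Dynkin

open Polynomial

/-- The pairs `(p, q) ≠ (0, 0)` with entries below `K`. -/
def pairRange (K : ℕ) : Finset (ℕ × ℕ) :=
  (Finset.range K ×ˢ Finset.range K).erase (0, 0)

/-- The lists of length `n` with entries in the finite set `I`. -/
def listsOfLength (I : Finset (ℕ × ℕ)) : ℕ → Finset (List (ℕ × ℕ))
  | 0 => {[]}
  | n + 1 => (I ×ˢ listsOfLength I n).image fun p => p.1 :: p.2

theorem mem_listsOfLength {I : Finset (ℕ × ℕ)} {n : ℕ} {P : List (ℕ × ℕ)} :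
    P ∈ listsOfLength I n ↔ P.length = n ∧ ∀ p ∈ P, p ∈ I := by
  induction n generalizing P with
  | zero => simp +contextual [listsOfLength, List.length_eq_zero_iff]
  | succ n ih =>
    rcases P with _ | ⟨p, P⟩
    · simp [listsOfLength]
    · simp [listsOfLength, ih, and_left_comm]

/-- The index set of the truncated Dynkin series. -/
def dynkinIndex (K : ℕ) : Finset (List (ℕ × ℕ)) :=
  (Finset.range K).biUnion fun n => listsOfLength (pairRange K) (n + 1)

theorem mem_dynkinIndex {K : ℕ} {P : List (ℕ × ℕ)} :
    P ∈ dynkinIndex K ↔ P ≠ [] ∧ P.length ≤ K ∧ ∀ p ∈ P, p ∈ pairRange K := by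
  simp only [dynkinIndex, Finset.mem_biUnion, Finset.mem_range, mem_listsOfLength]
  constructor
  · rintro ⟨n, hn, hl, hP⟩
    refine ⟨?_, by omega, hP⟩
    rintro rfl
    simp at hl
  · rintro ⟨h0, hl, hP⟩
    have := List.length_pos_iff.2 h0
    exact ⟨P.length - 1, by omega, by omega, hP⟩

/-- The coefficient of a word in the series of `log (e^x e^y)`. -/
def logCoeff (P : List (ℕ × ℕ)) : ℂ :=
  (-1 : ℂ) ^ (P.length - 1) / (P.length : ℂ) *
    (P.map fun p => ((p.1.factorial * p.2.factorial : ℕ) : ℂ)⁻¹).prod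

theorem length_bchWord (P : List (ℕ × ℕ)) :
    (bchWord P).length = (P.map fun p => p.1 + p.2).sum := by
  simp [bchWord, List.length_flatMap]

theorem bchCoeff_eq {K : ℕ} {P : List (ℕ × ℕ)} (hP : P ∈ dynkinIndex K) :
    bchCoeff P = ((bchWord P).length : ℂ)⁻¹ * logCoeff P := by
  rw [mem_dynkinIndex] at hP
  have h : ¬(P = [] ∨ ¬∀ p ∈ P, 0 < p.1 + p.2) := by
    push Not
    refine ⟨hP.1, fun p hp => ?_⟩
    have := hP.2.2 p hp
    simp only [pairRange, Finset.mem_erase, ne_eq, Prod.ext_iff] at this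
    omega
  have hprod : ((P.map fun p => (p.1.factorial * p.2.factorial : ℕ)).prod : ℂ)⁻¹ =
      (P.map fun p => ((p.1.factorial * p.2.factorial : ℕ) : ℂ)⁻¹).prod := by
    clear h hP
    induction P with
    | nil => simp
    | cons p P ih =>
      simp only [List.map_cons, List.prod_cons, Nat.cast_mul, mul_inv] at ih ⊢
      rw [ih]
  rw [bchCoeff, if_neg h, logCoeff, length_bchWord, mul_inv, hprod]
  ring

theorem length_le_bchWord {P : List (ℕ × ℕ)} (hP : ∀ p ∈ P, 0 < p.1 + p.2) :
    P.length ≤ (bchWord P).length := by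
  rw [length_bchWord]
  induction P with
  | nil => simp
  | cons p P ih =>
    have := hP p (by simp)
    have := ih fun q hq => hP q (by simp [hq])
    simp only [List.length_cons, List.map_cons, List.sum_cons]
    omega

theorem add_le_bchWord {P : List (ℕ × ℕ)} {p : ℕ × ℕ} (hp : p ∈ P) :
    p.1 + p.2 ≤ (bchWord P).length := by
  rw [length_bchWord]
  exact List.le_sum_of_mem (List.mem_map.2 ⟨p, hp, rfl⟩)

theorem mem_dynkinIndex_of_bchCoeff_ne_zero {P : List (ℕ × ℕ)} {K : ℕ} (h : bchCoeff P ≠ 0)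
    (hl : (bchWord P).length < K) : P ∈ dynkinIndex K := by
  have h' : ¬(P = [] ∨ ¬∀ p ∈ P, 0 < p.1 + p.2) := fun h' => h (by rw [bchCoeff, if_pos h'])
  push Not at h'
  refine mem_dynkinIndex.2 ⟨h'.1, (length_le_bchWord h'.2).trans hl.le, fun p hp => ?_⟩
  have h1 := add_le_bchWord hp
  have h2 := h'.2 p hp
  simp only [pairRange, Finset.mem_erase, ne_eq, Prod.ext_iff, Finset.mem_product,
    Finset.mem_range]
  omega

theorem bchWord_ne_nil {K : ℕ} {P : List (ℕ × ℕ)} (hP : P ∈ dynkinIndex K) :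
    bchWord P ≠ [] := by
  rw [mem_dynkinIndex] at hP
  obtain ⟨p, hp⟩ := List.exists_mem_of_ne_nil _ hP.1
  have h1 := add_le_bchWord hp
  have := hP.2.2 p hp
  simp only [pairRange, Finset.mem_erase, ne_eq, Prod.ext_iff] at this
  intro h
  rw [h, List.length_nil] at h1
  omega

/-- The right-nested bracket of a word in two letters, for an arbitrary bracket. -/
def nestWith {G : Type*} [Zero G] (β : G → G → G) (x y : G) : List Bool → G
  | [] => 0
  | [b] => if b then x else y
  | b :: (c :: rest) => β (if b then x else y) (nestWith β x y (c :: rest))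

section Ring

variable {R : Type*} [Ring R]

/-- The product of a word in two letters. -/
def wordProd (x y : R) (l : List Bool) : R := (l.map fun b => if b then x else y).prod

@[simp] theorem wordProd_cons (x y : R) (b : Bool) (l : List Bool) :
    wordProd x y (b :: l) = (if b then x else y) * wordProd x y l := by
  simp [wordProd]

theorem wordProd_append (x y : R) (l l' : List Bool) :
    wordProd x y (l ++ l') = wordProd x y l * wordProd x y l' := by
  simp [wordProd]

@[simp] theorem wordProd_nil (x y : R) : wordProd x y [] = 1 := rfl

@[simp] theorem wordProd_replicate_true (x y : R) (n : ℕ) :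
    wordProd x y (List.replicate n true) = x ^ n := by
  simp [wordProd]

@[simp] theorem wordProd_replicate_false (x y : R) (n : ℕ) :
    wordProd x y (List.replicate n false) = y ^ n := by
  simp [wordProd]

theorem wordProd_bchWord (x y : R) (P : List (ℕ × ℕ)) :
    wordProd x y (bchWord P) = (P.map fun p => x ^ p.1 * y ^ p.2).prod := by
  induction P with
  | nil => simp [bchWord]
  | cons p P ih =>
    rw [bchWord, List.flatMap_cons, wordProd_append, wordProd_append]
    rw [bchWord] at ih
    simp [ih]

theorem sum_listsOfLength (I : Finset (ℕ × ℕ)) (f : ℕ × ℕ → R) (n : ℕ) :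
    ∑ P ∈ listsOfLength I n, (P.map f).prod = (∑ p ∈ I, f p) ^ n := by
  induction n with
  | zero => simp [listsOfLength]
  | succ n ih =>
    rw [listsOfLength, Finset.sum_image (by rintro ⟨a, b⟩ _ ⟨c, d⟩ _ h; simpa using h),
      pow_succ', ← ih, Finset.sum_mul_sum, Finset.sum_product]
    simp

/-- The commutator of a ring as a plain function. -/
def commutator₂ (x y : R) : R := x * y - y * x

theorem monomial_wordProd (X₁ Y₁ : R) (l : List Bool) :
    wordProd (monomial 1 X₁) (monomial 1 Y₁) l = monomial l.length (wordProd X₁ Y₁ l) := by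
  induction l with
  | nil => simp
  | cons b l ih =>
    cases b <;> simp [ih, monomial_mul_monomial, add_comm]

theorem monomial_nestWith (X₁ Y₁ : R) (l : List Bool) :
    nestWith commutator₂ (monomial 1 X₁) (monomial 1 Y₁) l =
      monomial l.length (nestWith commutator₂ X₁ Y₁ l) := by
  induction l with
  | nil => simp [nestWith]
  | cons b l ih =>
    rcases l with _ | ⟨c, l⟩
    · cases b <;> simp [nestWith]
    · rw [nestWith, ih, nestWith]
      cases b <;> simp [commutator₂, monomial_mul_monomial, add_comm]

theorem map_wordProd {S : Type*} [Ring S] (f : R →+* S) (x y : R) (l : List Bool) :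
    f (wordProd x y l) = wordProd (f x) (f y) l := by
  induction l with
  | nil => simp
  | cons b l ih => cases b <;> simp [ih]

end Ring

variable {R : Type*} [Ring R] [Algebra ℂ R]

theorem nexp_mul_nexp_sub_one {x y : R} {K : ℕ} (hx : x ^ (K + 1) = 0) (hy : y ^ (K + 1) = 0) :
    nexp x * nexp y - 1 = ∑ p ∈ pairRange (K + 1),
      ((p.1.factorial * p.2.factorial : ℕ) : ℂ)⁻¹ • (x ^ p.1 * y ^ p.2) := by
  rw [nexp_eq_sum hx, nexp_eq_sum hy, Finset.sum_mul_sum, ← Finset.sum_product', pairRange,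
    sub_eq_iff_eq_add]
  rw [← Finset.sum_erase_add (a := ((0, 0) : ℕ × ℕ)) _ _ (by simp)]
  simp [smul_smul, mul_comm]

theorem list_smul_prod (P : List (ℕ × ℕ)) (c : ℕ × ℕ → ℂ) (f : ℕ × ℕ → R) :
    (P.map fun p => c p • f p).prod = (P.map c).prod • (P.map f).prod := by
  induction P with
  | nil => simp
  | cons p P ih => simp [ih, smul_smul, mul_comm]

theorem aeval_logPoly_mul {x y : R} {K : ℕ} (hx : x ^ (K + 1) = 0) (hy : y ^ (K + 1) = 0) :
    aeval (nexp x * nexp y - 1) (logPoly (K + 1)) =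
      ∑ P ∈ dynkinIndex (K + 1), logCoeff P • wordProd x y (bchWord P) := by
  rw [dynkinIndex, Finset.sum_biUnion]
  · rw [logPoly, map_sum]
    refine Finset.sum_congr rfl fun n _ => ?_
    rw [nexp_mul_nexp_sub_one hx hy, map_mul, aeval_C, map_pow, aeval_X, ← sum_listsOfLength,
      ← Algebra.smul_def, Finset.smul_sum]
    refine Finset.sum_congr rfl fun P hP => ?_
    rw [list_smul_prod, smul_smul, wordProd_bchWord, logCoeff, (mem_listsOfLength.1 hP).1]
    simp
  · intro m _ n _ hmn
    refine Finset.disjoint_left.2 fun P hP hP' => hmn ?_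
    have h1 := (mem_listsOfLength.1 hP).1
    have h2 := (mem_listsOfLength.1 hP').1
    omega

theorem isNilpotent_nexp_mul_sub_one {x y : R} {K : ℕ}
    (h : ∀ l : List Bool, K < l.length → wordProd x y l = 0) :
    (nexp x * nexp y - 1) ^ (K + 1) = 0 := by
  have hx : x ^ (K + 1) = 0 := by simpa using h (List.replicate (K + 1) true) (by simp)
  have hy : y ^ (K + 1) = 0 := by simpa using h (List.replicate (K + 1) false) (by simp)
  rw [nexp_mul_nexp_sub_one hx hy, ← sum_listsOfLength]
  refine Finset.sum_eq_zero fun P hP => ?_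
  rw [list_smul_prod, ← wordProd_bchWord, h, smul_zero]
  rw [mem_listsOfLength] at hP
  have := length_le_bchWord (P := P) fun p hp => by
    have := hP.2 p hp
    simp only [pairRange, Finset.mem_erase, ne_eq, Prod.ext_iff] at this
    omega
  omega

theorem wordProd_adEnd {x y E : R} (hx : E * x - x * E = x) (hy : E * y - y * E = y)
    {l : List Bool} (hl : l ≠ []) :
    wordProd (adEnd x) (adEnd y) l E = -nestWith commutator₂ x y l := by
  induction l with
  | nil => exact absurd rfl hl
  | cons b l ih =>
    rcases l with _ | ⟨c, l⟩
    · cases b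
      · simpa [nestWith] using by rw [← neg_sub, hy]
      · simpa [nestWith] using by rw [← neg_sub, hx]
    · have := ih (by simp)
      rw [wordProd_cons, Module.End.mul_apply, this, nestWith]
      cases b <;> simp [commutator₂] <;> abel

theorem map_nestWith {G H : Type*} [Zero G] [Zero H] {β : G → G → G} {β' : H → H → H}
    {f : G → H} (f0 : f 0 = 0) (hf : ∀ a b, f (β a b) = β' (f a) (f b)) (x y : G)
    (l : List Bool) : f (nestWith β x y l) = nestWith β' (f x) (f y) l := by
  induction l with
  | nil => simp [nestWith, f0]
  | cons b l ih =>
    rcases l with _ | ⟨c, l⟩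
    · cases b <;> simp [nestWith]
    · rw [nestWith, nestWith, hf, ih]
      cases b <;> simp

/-- The Euler operator `s d/ds` on polynomials in `s`. -/
def eulerOp (R : Type*) [Ring R] [Algebra ℂ R] : Module.End ℂ R[X] :=
  LinearMap.mulLeft ℂ X ∘ₗ derivative.restrictScalars ℂ

theorem eulerOp_monomial (n : ℕ) (a : R) :
    eulerOp R (monomial n a) = monomial n ((n : ℂ) • a) := by
  rcases n with _ | n
  · simp [eulerOp]
  · simp [eulerOp, X_mul_monomial, Algebra.smul_def]
    rw [mul_add, add_mul, (Nat.cast_commute n a).eq]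
    simp

theorem eulerOp_commutator (p : R[X]) :
    eulerOp R * Algebra.lmul ℂ R[X] p - Algebra.lmul ℂ R[X] p * eulerOp R =
      Algebra.lmul ℂ R[X] (eulerOp R p) := by
  ext1 q
  simp only [eulerOp, LinearMap.sub_apply, Module.End.mul_apply, LinearMap.comp_apply,
    LinearMap.mulLeft_apply, LinearMap.restrictScalars_apply, Algebra.coe_lmul_eq_mul,
    LinearMap.mul_apply', derivative_mul, mul_add]
  rw [← mul_assoc, ← mul_assoc, ← mul_assoc, X_mul]
  simp [mul_assoc, X_mul]

theorem lmul_injective : Function.Injective (Algebra.lmul ℂ R[X]) := by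
  intro p q h
  simpa using congrArg (fun f => f 1) h

/-- **Dynkin's formula**: `log (e^x e^y)` is the sum of the right-nested commutators of words,
weighted by the inverses of their lengths. -/
theorem exists_dynkin {x y : R} {N : ℕ}
    (h : ∀ l : List Bool, N < l.length → wordProd x y l = 0) :
    ∃ K₀, ∀ K, K₀ ≤ K → aeval (nexp x * nexp y - 1) (logPoly (K + 1)) =
      ∑ P ∈ dynkinIndex (K + 1), bchCoeff P • nestWith commutator₂ x y (bchWord P) := by
  set Λ := Algebra.lmul ℂ R[X]
  set E := eulerOp R
  set x' := Λ (monomial 1 x) with hx'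
  set y' := Λ (monomial 1 y) with hy'
  have hw : ∀ l, wordProd x' y' l = Λ (monomial l.length (wordProd x y l)) := fun l => by
    rw [← monomial_wordProd]
    exact (map_wordProd Λ.toRingHom _ _ _).symm
  have hn : ∀ l, nestWith commutator₂ x' y' l =
      Λ (monomial l.length (nestWith commutator₂ x y l)) := fun l => by
    rw [← monomial_nestWith]
    exact (map_nestWith (map_zero Λ) (fun a b => by simp [commutator₂]) _ _ _).symm
  have h' : ∀ l : List Bool, N < l.length → wordProd x' y' l = 0 := fun l hl => by
    rw [hw, h l hl, map_zero, map_zero]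
  have pw : ∀ {S : Type _} [Ring S] (a b : S),
      (∀ l : List Bool, N < l.length → wordProd a b l = 0) →
      a ^ (N + 1) = 0 ∧ b ^ (N + 1) = 0 := fun a b h =>
    ⟨by simpa using h (List.replicate (N + 1) true) (by simp),
      by simpa using h (List.replicate (N + 1) false) (by simp)⟩
  obtain ⟨hx, hy⟩ := pw x y h
  obtain ⟨hx1, hy1⟩ := pw x' y' h'
  have nx : IsNilpotent x' := ⟨_, hx1⟩
  have ny : IsNilpotent y' := ⟨_, hy1⟩
  have hE : ∀ p, E * Λ p - Λ p * E = Λ (E p) := eulerOp_commutator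
  have hEx : E * x' - x' * E = x' := by rw [hE, eulerOp_monomial]; simp [hx']
  have hEy : E * y' - y' * E = y' := by rw [hE, eulerOp_monomial]; simp [hy']
  have hu := isNilpotent_nexp_mul_sub_one h'
  obtain ⟨z, hz, nz⟩ : ∃ z, (∀ K, N ≤ K → aeval (nexp x' * nexp y' - 1) (logPoly (K + 1)) = z) ∧
      IsNilpotent z := by
    refine ⟨aeval (nexp x' * nexp y' - 1) (logPoly (N + 1)), fun K hK => ?_,
      ⟨_, aeval_logPoly_pow hu _⟩⟩
    have hu' := pow_eq_zero_of_le (show N + 1 ≤ K + 1 by omega) hu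
    refine nexp_injective ⟨_, aeval_logPoly_pow hu' _⟩ ⟨_, aeval_logPoly_pow hu _⟩ ?_
    rw [nexp_aeval_logPoly hu, nexp_aeval_logPoly hu']
  have ez : nexp z = nexp x' * nexp y' := by
    rw [← hz N le_rfl, nexp_aeval_logPoly hu, add_sub_cancel]
  have ez' : nexp (-z) = nexp (-y') * nexp (-x') := by
    have h1 := nexp_neg_mul_nexp nz
    have h2 : nexp z * (nexp (-y') * nexp (-x')) = 1 := by
      rw [ez, mul_assoc, ← mul_assoc (nexp y'), nexp_mul_nexp_neg ny, one_mul,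
        nexp_mul_nexp_neg nx]
    exact left_inv_eq_right_inv h1 h2
  have ead : nexp (adEnd z) = nexp (adEnd x') * nexp (adEnd y') := by
    ext1 b
    rw [Module.End.mul_apply, nexp_adEnd nz, nexp_adEnd ny, nexp_adEnd nx, ez, ez']
    simp only [mul_assoc]
  obtain ⟨k1, hk1⟩ := isNilpotent_adEnd nx
  obtain ⟨k2, hk2⟩ := isNilpotent_adEnd ny
  obtain ⟨k3, hk3⟩ := isNilpotent_adEnd nz
  refine ⟨N + k1 + k2 + k3, fun K hK => ?_⟩
  have key : (∑ P ∈ dynkinIndex (K + 1), logCoeff P • monomial (bchWord P).length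
        (((bchWord P).length : ℂ) • wordProd x y (bchWord P)) : R[X]) =
      ∑ P ∈ dynkinIndex (K + 1), logCoeff P • monomial (bchWord P).length
        (nestWith commutator₂ x y (bchWord P)) := by
    apply lmul_injective (R := R)
    change Λ _ = Λ _
    have hk1' : adEnd x' ^ (K + 1) = 0 := pow_eq_zero_of_le (by omega) hk1
    have hk2' : adEnd y' ^ (K + 1) = 0 := pow_eq_zero_of_le (by omega) hk2
    have hk3' : adEnd z ^ (K + 1) = 0 := pow_eq_zero_of_le (by omega) hk3
    have e1 := aeval_logPoly_nexp (R := Module.End ℂ (Module.End ℂ R[X])) (z := adEnd z)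
      (K := K) hk3'
    rw [ead, aeval_logPoly_mul (R := Module.End ℂ (Module.End ℂ R[X])) (x := adEnd x')
      (y := adEnd y') (K := K) hk1' hk2'] at e1
    have e2 := congrArg (fun f => -f E) e1
    simp only [LinearMap.sum_apply, LinearMap.smul_apply, adEnd_apply, neg_sub] at e2
    rw [← hz K (by omega), aeval_logPoly_mul
      (pow_eq_zero_of_le (show N + 1 ≤ K + 1 by omega) hx1)
      (pow_eq_zero_of_le (show N + 1 ≤ K + 1 by omega) hy1), Finset.mul_sum, Finset.sum_mul,
      ← Finset.sum_sub_distrib, ← Finset.sum_neg_distrib] at e2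
    rw [map_sum, map_sum]
    refine Eq.trans ?_ (e2.symm.trans ?_)
    · refine Finset.sum_congr rfl fun P _ => ?_
      rw [mul_smul_comm, smul_mul_assoc, ← smul_sub, hw, hE, eulerOp_monomial, map_smul]
    · refine Finset.sum_congr rfl fun P hP => ?_
      rw [wordProd_adEnd hEx hEy (bchWord_ne_nil hP), hn, smul_neg, neg_neg, map_smul]
  rw [aeval_logPoly_mul (pow_eq_zero_of_le (show N + 1 ≤ K + 1 by omega) hx)
      (pow_eq_zero_of_le (show N + 1 ≤ K + 1 by omega) hy)]
  obtain ⟨m, hm⟩ : ∃ m, ∀ P ∈ dynkinIndex (K + 1), (bchWord P).length < m :=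
    ⟨(dynkinIndex (K + 1)).sup (fun P => (bchWord P).length) + 1, fun P hP =>
      Nat.lt_succ_of_le (Finset.le_sup (f := fun P => (bchWord P).length) hP)⟩
  have e3 := congrArg (fun p : R[X] => ∑ n ∈ Finset.range m, (n : ℂ)⁻¹ • p.coeff n) key
  simp only [finsetSum_coeff, coeff_smul, coeff_monomial, Finset.smul_sum] at e3
  rw [Finset.sum_comm, Finset.sum_comm (s := Finset.range m)] at e3
  refine Eq.trans ?_ (e3.trans ?_)
  · refine Finset.sum_congr rfl fun P hP => ?_
    have h0 : ((bchWord P).length : ℂ) ≠ 0 := by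
      exact_mod_cast (List.length_pos_iff.2 (bchWord_ne_nil hP)).ne'
    rw [Finset.sum_eq_single_of_mem _ (Finset.mem_range.2 (hm P hP))
      (fun n _ hn => by rw [if_neg (Ne.symm hn), smul_zero, smul_zero]), if_pos rfl, smul_smul,
      smul_smul, mul_right_comm, inv_mul_cancel₀ h0, one_mul]
  · refine Finset.sum_congr rfl fun P hP => ?_
    rw [Finset.sum_eq_single_of_mem _ (Finset.mem_range.2 (hm P hP))
      (fun n _ hn => by rw [if_neg (Ne.symm hn), smul_zero, smul_zero]), if_pos rfl, smul_smul,
      bchCoeff_eq hP]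

end Dynkin

section Gauge

/-- A bilinear map `ρ` strictly raises a finite decreasing filtration of its target. -/
def NilAct {G U : Type*} [AddCommGroup G] [Module ℂ G] [AddCommGroup U] [Module ℂ U]
    (ρ : G →ₗ[ℂ] U →ₗ[ℂ] U) : Prop :=
  ∃ F : ℕ → Submodule ℂ U, (Antitone F ∧ F 0 = ⊤) ∧ (∀ i a u, u ∈ F i → ρ a u ∈ F (i + 1)) ∧
    ∃ K, ∀ n, K ≤ n → F n = ⊥

/-- A nilpotent bracket acting nilpotently on `U`, together with a derivation with values
in `U`. -/
structure GaugeData (G U : Type*) [AddCommGroup G] [Module ℂ G] [AddCommGroup U]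
    [Module ℂ U] where
  br : G →ₗ[ℂ] G →ₗ[ℂ] G
  act : G →ₗ[ℂ] U →ₗ[ℂ] U
  d : G →ₗ[ℂ] U
  act_br : ∀ a b u, act (br a b) u = act a (act b u) - act b (act a u)
  d_br : ∀ a b, d (br a b) = act a (d b) - act b (d a)
  nil_br : NilAct br
  nil_act : NilAct act

namespace GaugeData

variable {G U : Type*} [AddCommGroup G] [Module ℂ G] [AddCommGroup U] [Module ℂ U]
variable {G' U' : Type*} [AddCommGroup G'] [Module ℂ G'] [AddCommGroup U'] [Module ℂ U']
variable (D : GaugeData G U) (D' : GaugeData G' U')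

/-- The gauge action `x ↦ x + Σ act_a^n / (n+1)! (act_a x - d a)`. -/
def gauge (a : G) (x : U) : U :=
  x + ∑ᶠ n : ℕ, (((n + 1).factorial : ℂ))⁻¹ • (D.act a)^[n] (D.act a x - D.d a)

/-- The Baker-Campbell-Hausdorff product. -/
def bch (a b : G) : G :=
  ∑ᶠ P : List (ℕ × ℕ), bchCoeff P • nestWith (fun x y => D.br x y) a b (bchWord P)

theorem exists_act_pow : ∃ K, ∀ a n, K ≤ n → D.act a ^ n = 0 := by
  obtain ⟨F, ⟨-, h0⟩, h1, K, hK⟩ := D.nil_act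
  refine ⟨K, fun a n hn => LinearMap.ext fun u => ?_⟩
  have : ∀ m, (D.act a ^ m) u ∈ F m := fun m => by
    induction m with
    | zero => simp [h0]
    | succ m ih =>
      rw [pow_succ', Module.End.mul_apply]
      exact h1 _ _ _ ih
  simpa [hK n hn] using this n

theorem gauge_eq_sum : ∃ K₀, ∀ K, K₀ ≤ K → ∀ a x, D.gauge a x =
    x + ∑ n ∈ Finset.range K, (((n + 1).factorial : ℂ))⁻¹ • (D.act a ^ n) (D.act a x - D.d a) := by
  obtain ⟨K₀, hK₀⟩ := D.exists_act_pow
  refine ⟨K₀, fun K hK a x => ?_⟩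
  rw [gauge, finsum_eq_sum_of_support_subset (s := Finset.range K)]
  · simp only [Module.End.pow_apply]
  · intro n hn
    rw [Finset.mem_coe, Finset.mem_range]
    by_contra hc
    refine hn ?_
    dsimp only
    rw [← Module.End.pow_apply, hK₀ a n (by omega), LinearMap.zero_apply, smul_zero]

theorem bch_eq_sum : ∃ K₀, ∀ K, K₀ ≤ K → ∀ a b, D.bch a b =
    ∑ P ∈ dynkinIndex K, bchCoeff P • nestWith (fun x y => D.br x y) a b (bchWord P) := by
  obtain ⟨F, ⟨-, h0⟩, h1, K₀, hK₀⟩ := D.nil_br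
  have key : ∀ a b c l, nestWith (fun x y => D.br x y) a b (c :: l) ∈ F l.length := by
    intro a b c l
    induction l generalizing c with
    | nil => simp [h0]
    | cons c' l ih => exact h1 _ _ _ (ih c')
  refine ⟨K₀ + 1, fun K hK a b => ?_⟩
  rw [bch, finsum_eq_sum_of_support_subset]
  intro P hP
  have hc : bchCoeff P ≠ 0 := fun h => hP (by simp [h])
  refine mem_dynkinIndex_of_bchCoeff_ne_zero hc ?_
  by_contra hl
  refine hP ?_
  dsimp only
  rcases hw : bchWord P with _ | ⟨c, l⟩
  · simp [nestWith]
  · have := key a b c l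
    rw [hw, List.length_cons] at hl
    rw [hK₀ _ (by omega)] at this
    rw [(Submodule.mem_bot ℂ).1 this, smul_zero]

theorem gauge_map (f : U →ₗ[ℂ] U') {a : G} {a' : G'}
    (hact : ∀ u, f (D.act a u) = D'.act a' (f u)) (hd : f (D.d a) = D'.d a') (x : U) :
    f (D.gauge a x) = D'.gauge a' (f x) := by
  obtain ⟨K, hK⟩ := D.gauge_eq_sum
  obtain ⟨K', hK'⟩ := D'.gauge_eq_sum
  have hp : ∀ n u, f ((D.act a ^ n) u) = (D'.act a' ^ n) (f u) := fun n u => by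
    induction n with
    | zero => rfl
    | succ n ih => rw [pow_succ', pow_succ', Module.End.mul_apply, hact, ih, Module.End.mul_apply]
  rw [hK (K + K') (by omega), hK' (K + K') (by omega), map_add, map_sum]
  simp only [map_smul, hp, map_sub, hact, hd]

theorem bch_map (f : G →ₗ[ℂ] G') (hf : ∀ a b, f (D.br a b) = D'.br (f a) (f b)) (a b : G) :
    f (D.bch a b) = D'.bch (f a) (f b) := by
  obtain ⟨K, hK⟩ := D.bch_eq_sum
  obtain ⟨K', hK'⟩ := D'.bch_eq_sum
  rw [hK (K + K') (by omega), hK' (K + K') (by omega), map_sum]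
  refine Finset.sum_congr rfl fun P _ => ?_
  rw [map_smul]
  congr 1
  exact map_nestWith (map_zero f) hf a b _

/-- The affine representation of `G` on `U × ℂ`. -/
def aff : G →ₗ[ℂ] Module.End ℂ (U × ℂ) where
  toFun a := (D.act a ∘ₗ LinearMap.fst ℂ U ℂ -
    (LinearMap.toSpanSingleton ℂ U (D.d a)) ∘ₗ LinearMap.snd ℂ U ℂ).prod 0
  map_add' a b := by
    ext <;> simp; abel
  map_smul' c a := by
    ext <;> simp

@[simp] theorem aff_apply (a : G) (v : U × ℂ) :
    D.aff a v = (D.act a v.1 - v.2 • D.d a, 0) := by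
  simp [aff]

theorem aff_br (a b : G) : D.aff (D.br a b) = commutator₂ (D.aff a) (D.aff b) := by
  refine LinearMap.ext fun v => ?_
  simp only [commutator₂, aff_apply, LinearMap.sub_apply, Module.End.mul_apply, D.act_br, D.d_br,
    map_sub, map_smul, zero_smul, sub_zero, Prod.mk_sub_mk, smul_sub]
  congr 1
  abel

theorem exists_wordProd_aff :
    ∃ N, ∀ a b, ∀ l : List Bool, N < l.length → wordProd (D.aff a) (D.aff b) l = 0 := by
  obtain ⟨F, ⟨-, h0⟩, h1, K, hK⟩ := D.nil_act
  refine ⟨K, fun a b l hl => ?_⟩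
  rcases l with _ | ⟨c, l⟩
  · simp at hl
  have key : ∀ v, (wordProd (D.aff a) (D.aff b) (c :: l) v).1 ∈ F l.length ∧
      (wordProd (D.aff a) (D.aff b) (c :: l) v).2 = 0 := fun v => by
    clear hl
    induction l generalizing c with
    | nil => cases c <;> simp [h0]
    | cons c' l ih =>
      rw [wordProd_cons, Module.End.mul_apply]
      obtain ⟨i1, i2⟩ := ih c'
      generalize wordProd (D.aff a) (D.aff b) (c' :: l) v = u at i1 i2
      cases c
      · simpa [i2] using h1 _ _ _ i1
      · simpa [i2] using h1 _ _ _ i1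
  refine LinearMap.ext fun v => Prod.ext ?_ (key v).2
  have := (key v).1
  rwa [hK _ (by simpa using hl)] at this

theorem isNilpotent_aff (a : G) : IsNilpotent (D.aff a) := by
  obtain ⟨N, hN⟩ := D.exists_wordProd_aff
  exact ⟨N + 1, by simpa using hN a a (List.replicate (N + 1) true) (by simp)⟩

theorem aff_pow_succ (a : G) (x : U) (n : ℕ) :
    (D.aff a ^ (n + 1)) (x, (1 : ℂ)) = ((D.act a ^ n) (D.act a x - D.d a), 0) := by
  induction n with
  | zero => simp
  | succ n ih => rw [pow_succ', Module.End.mul_apply, ih]; simp [pow_succ']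

theorem nexp_aff (a : G) (x : U) : nexp (D.aff a) (x, (1 : ℂ)) = (D.gauge a x, 1) := by
  obtain ⟨K, hK⟩ := D.gauge_eq_sum
  obtain ⟨k, hk⟩ := D.isNilpotent_aff a
  have hk' : D.aff a ^ (K + k + 1) = 0 := pow_eq_zero_of_le (by omega) hk
  rw [nexp_eq_sum (R := Module.End ℂ (U × ℂ)) hk', Finset.sum_range_succ', hK (K + k) (by omega),
    LinearMap.add_apply, LinearMap.sum_apply]
  simp only [LinearMap.smul_apply, aff_pow_succ]
  refine Prod.ext ?_ ?_
  · simp [Prod.fst_sum, add_comm]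
  · simp [Prod.snd_sum]

theorem nexp_aff_bch (a b : G) :
    nexp (D.aff (D.bch a b)) = nexp (D.aff a) * nexp (D.aff b) := by
  obtain ⟨N, hN⟩ := D.exists_wordProd_aff
  obtain ⟨K, hK⟩ := D.bch_eq_sum
  obtain ⟨K', hK'⟩ := exists_dynkin (hN a b)
  have hu := isNilpotent_nexp_mul_sub_one (hN a b)
  have hu' : (nexp (D.aff a) * nexp (D.aff b) - 1) ^ (N + K + K' + 1) = 0 :=
    pow_eq_zero_of_le (by omega) hu
  have h1 : D.aff (D.bch a b) =
      Polynomial.aeval (nexp (D.aff a) * nexp (D.aff b) - 1) (logPoly (N + K + K' + 1)) := by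
    rw [hK' _ (by omega), hK (N + K + K' + 1) (by omega), map_sum]
    refine Finset.sum_congr rfl fun P _ => ?_
    rw [map_smul]
    congr 1
    exact map_nestWith (map_zero _) D.aff_br a b _
  rw [h1, nexp_aeval_logPoly (R := Module.End ℂ (U × ℂ)) hu', add_sub_cancel]

theorem gauge_bch (a b : G) (x : U) : D.gauge (D.bch a b) x = D.gauge a (D.gauge b x) := by
  have := congrArg (fun f => (f (x, (1 : ℂ))).1) (D.nexp_aff_bch a b)
  simpa [nexp_aff] using this

@[simp] theorem gauge_zero (x : U) : D.gauge 0 x = x := by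
  have := D.nexp_aff 0 x
  rw [map_zero, nexp_zero] at this
  exact (congrArg Prod.fst this).symm

theorem gauge_neg_gauge (a : G) (x : U) : D.gauge (-a) (D.gauge a x) = x := by
  have := congrArg (fun f => (f (x, (1 : ℂ))).1) (nexp_neg_mul_nexp (D.isNilpotent_aff a))
  simpa [nexp_aff, ← map_neg] using this

theorem gauge_gauge_neg (a : G) (x : U) : D.gauge a (D.gauge (-a) x) = x := by
  simpa using D.gauge_neg_gauge (-a) x

theorem aff_eq_zero_of_nexp {a : G} {v : U × ℂ} (h : nexp (D.aff a) v = v) : D.aff a v = 0 := by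
  obtain ⟨k, hk⟩ := D.isNilpotent_aff a
  have hk' : D.aff a ^ (k + 1) = 0 := pow_eq_zero_of_le (by omega) hk
  obtain ⟨q, hq⟩ := X_dvd_logPoly (k + 1)
  rw [← aeval_logPoly_nexp (R := Module.End ℂ (U × ℂ)) hk', hq, mul_comm, map_mul,
    Module.End.mul_apply, Polynomial.aeval_X, LinearMap.sub_apply, h, Module.End.one_apply,
    sub_self, map_zero]

theorem gauge_eq_self_iff {a : G} {x : U} : D.gauge a x = x ↔ D.act a x = D.d a := by
  constructor
  · intro h
    have := D.aff_eq_zero_of_nexp (a := a) (v := (x, (1 : ℂ))) (by rw [nexp_aff, h])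
    simpa [sub_eq_zero] using this
  · intro h
    obtain ⟨K, hK⟩ := D.gauge_eq_sum
    simp [hK K le_rfl, h]

end GaugeData

end Gauge

section Poly

variable {X Y Z X' Y' Z' : Type*} [AddCommGroup X] [Module ℂ X] [AddCommGroup Y] [Module ℂ Y]
  [AddCommGroup Z] [Module ℂ Z] [AddCommGroup X'] [Module ℂ X'] [AddCommGroup Y'] [Module ℂ Y']
  [AddCommGroup Z'] [Module ℂ Z']

/-- The coefficientwise extension of a bilinear map to polynomials. -/
def polyConv (f : X →ₗ[ℂ] Y →ₗ[ℂ] Z) : (ℕ →₀ X) →ₗ[ℂ] (ℕ →₀ Y) →ₗ[ℂ] (ℕ →₀ Z) :=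
  LinearMap.mk₂ ℂ (fun p q => p.sum fun i x => q.sum fun j y => Finsupp.single (i + j) (f x y))
    (fun p p' q => Finsupp.sum_add_index' (by simp) (by simp [Finsupp.sum_add]))
    (fun c p q => by
      rw [Finsupp.sum_smul_index' (by simp), Finsupp.smul_sum]
      simp [Finsupp.smul_sum])
    (fun p q q' => by
      rw [← Finsupp.sum_add]
      refine Finsupp.sum_congr fun i _ => Finsupp.sum_add_index' (by simp) (by simp))
    (fun c p q => by
      rw [Finsupp.smul_sum]
      refine Finsupp.sum_congr fun i _ => ?_
      rw [Finsupp.sum_smul_index' (by simp), Finsupp.smul_sum]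
      simp)

theorem polyConv_apply (f : X →ₗ[ℂ] Y →ₗ[ℂ] Z) (p : ℕ →₀ X) (q : ℕ →₀ Y) :
    polyConv f p q = p.sum fun i x => q.sum fun j y => Finsupp.single (i + j) (f x y) := rfl

@[simp] theorem polyConv_single_single (f : X →ₗ[ℂ] Y →ₗ[ℂ] Z) (i j : ℕ) (x : X) (y : Y) :
    polyConv f (Finsupp.single i x) (Finsupp.single j y) = Finsupp.single (i + j) (f x y) := by
  simp [polyConv_apply]

theorem polyConv_single_zero_apply (f : X →ₗ[ℂ] Y →ₗ[ℂ] Z) (x : X) (q : ℕ →₀ Y) (n : ℕ) :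
    polyConv f (Finsupp.single 0 x) q n = f x (q n) := by
  induction q using Finsupp.induction_linear with
  | zero => simp
  | add q q' h h' => simp [h, h']
  | single j y =>
    rw [polyConv_single_single, zero_add]
    by_cases h : j = n
    · subst h; simp
    · simp [h]

theorem polyConv_neg (f : X →ₗ[ℂ] Y →ₗ[ℂ] Z) (p : ℕ →₀ X) (q : ℕ →₀ Y) :
    polyConv (-f) p q = -polyConv f p q := by
  induction p using Finsupp.induction_linear with
  | zero => simp
  | add p p' h h' => simp [h, h']; abel
  | single i x =>
    induction q using Finsupp.induction_linear with
    | zero => simp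
    | add p p' h h' => rw [map_add, map_add, h, h', neg_add]
    | single j y => simp

/-- The coefficientwise extension of a linear map to polynomials. -/
abbrev polyMap (f : X →ₗ[ℂ] Y) : (ℕ →₀ X) →ₗ[ℂ] (ℕ →₀ Y) := Finsupp.mapRange.linearMap f

theorem polyMap_single (f : X →ₗ[ℂ] Y) (i : ℕ) (x : X) :
    polyMap f (Finsupp.single i x) = Finsupp.single i (f x) := by
  simp

theorem polyMap_eq_sum (f : X →ₗ[ℂ] Y) (p : ℕ →₀ X) :
    (p.sum fun i v => Finsupp.single i (f v)) = polyMap f p := by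
  induction p using Finsupp.induction_linear with
  | zero => simp
  | add p q h h' => rw [Finsupp.sum_add_index' (by simp) (by simp), h, h', map_add]
  | single i x => simp

/-- The formal derivative. -/
def polyDeriv : (ℕ →₀ X) →ₗ[ℂ] (ℕ →₀ X) :=
  Finsupp.lsum ℂ fun i => Finsupp.lsingle (i - 1) ∘ₗ ((i : ℂ) • LinearMap.id)

theorem polyDeriv_eq_sum (p : ℕ →₀ X) :
    polyDeriv p = p.sum fun i v => Finsupp.single (i - 1) ((i : ℂ) • v) := rfl

@[simp] theorem polyDeriv_single (i : ℕ) (x : X) :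
    polyDeriv (Finsupp.single i x) = Finsupp.single (i - 1) ((i : ℂ) • x) := by
  simp [polyDeriv_eq_sum]

/-- The primitive vanishing at the origin. -/
def polyInt : (ℕ →₀ X) →ₗ[ℂ] (ℕ →₀ X) :=
  Finsupp.lsum ℂ fun i => Finsupp.lsingle (i + 1) ∘ₗ (((i : ℂ) + 1)⁻¹ • LinearMap.id)

@[simp] theorem polyInt_single (i : ℕ) (x : X) :
    polyInt (Finsupp.single i x) = Finsupp.single (i + 1) (((i : ℂ) + 1)⁻¹ • x) := by
  simp [polyInt]

/-- Evaluation at a scalar. -/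
def polyEval (c : ℂ) : (ℕ →₀ X) →ₗ[ℂ] X := Finsupp.lsum ℂ fun i => (c ^ i) • LinearMap.id

theorem polyEval_eq_sum (c : ℂ) (p : ℕ →₀ X) : polyEval c p = p.sum fun i v => (c ^ i) • v := rfl

@[simp] theorem polyEval_single (c : ℂ) (i : ℕ) (x : X) :
    polyEval c (Finsupp.single i x) = c ^ i • x := by
  simp [polyEval_eq_sum]

@[simp] theorem polyDeriv_polyInt (p : ℕ →₀ X) : polyDeriv (polyInt p) = p := by
  induction p using Finsupp.induction_linear with
  | zero => simp
  | add p q h h' => simp [h, h']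
  | single i x => simp [smul_smul, mul_inv_cancel₀ (Nat.cast_add_one_ne_zero (R := ℂ) i)]

@[simp] theorem polyEval_zero_polyInt (p : ℕ →₀ X) : polyEval 0 (polyInt p) = 0 := by
  induction p using Finsupp.induction_linear with
  | zero => simp
  | add p q h h' => simp [h, h']
  | single i x => simp

theorem polyInt_polyDeriv (p : ℕ →₀ X) :
    polyInt (polyDeriv p) = p - Finsupp.single 0 (polyEval 0 p) := by
  induction p using Finsupp.induction_linear with
  | zero => simp
  | add p q h h' => simp [h, h']; abel
  | single i x =>
    rcases i with _ | i
    · simp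
    · simp [smul_smul, inv_mul_cancel₀ (Nat.cast_add_one_ne_zero (R := ℂ) i)]

theorem eq_single_of_polyDeriv {p : ℕ →₀ X} (h : polyDeriv p = 0) :
    p = Finsupp.single 0 (polyEval 0 p) := by
  have := polyInt_polyDeriv p
  rwa [h, map_zero, eq_comm, sub_eq_zero] at this

theorem polyDeriv_apply (p : ℕ →₀ X) (n : ℕ) :
    polyDeriv p n = ((n : ℂ) + 1) • p (n + 1) := by
  induction p using Finsupp.induction_linear with
  | zero => simp
  | add p q h h' => simp [h, h']
  | single i x =>
    rcases i with _ | i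
    · simp
    · by_cases h : i = n
      · subst h; simp
      · simp [h]

theorem polyDeriv_polyConv (f : X →ₗ[ℂ] Y →ₗ[ℂ] Z) (p : ℕ →₀ X) (q : ℕ →₀ Y) :
    polyDeriv (polyConv f p q) = polyConv f (polyDeriv p) q + polyConv f p (polyDeriv q) := by
  induction p using Finsupp.induction_linear with
  | zero => simp
  | add p p' h h' => simp [h, h']; abel
  | single i x =>
    induction q using Finsupp.induction_linear with
    | zero => simp
    | add p p' h h' => simp [h, h']; abel
    | single j y =>
      rcases i with _ | i <;> rcases j with _ | j
      · simp
      · simp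
      · simp
      · simp [add_smul, add_right_comm i 1, ← add_assoc]
        abel

@[simp] theorem polyEval_polyConv (c : ℂ) (f : X →ₗ[ℂ] Y →ₗ[ℂ] Z) (p : ℕ →₀ X) (q : ℕ →₀ Y) :
    polyEval c (polyConv f p q) = f (polyEval c p) (polyEval c q) := by
  induction p using Finsupp.induction_linear with
  | zero => simp
  | add p p' h h' => simp [h, h']
  | single i x =>
    induction q using Finsupp.induction_linear with
    | zero => simp
    | add p p' h h' => rw [map_add, map_add, h, h', map_add, map_add]
    | single j y => simp [pow_add, smul_smul, mul_comm]

@[simp] theorem polyEval_polyMap (c : ℂ) (f : X →ₗ[ℂ] Y) (p : ℕ →₀ X) :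
    polyEval c (polyMap f p) = f (polyEval c p) := by
  induction p using Finsupp.induction_linear with
  | zero => simp
  | add p q h h' => rw [map_add, map_add, h, h', map_add, map_add]
  | single i x => simp

theorem polyDeriv_polyMap (f : X →ₗ[ℂ] Y) (p : ℕ →₀ X) :
    polyDeriv (polyMap f p) = polyMap f (polyDeriv p) := by
  induction p using Finsupp.induction_linear with
  | zero => simp
  | add p q h h' => rw [map_add, map_add, h, h', map_add, map_add]
  | single i x => simp

theorem polyMap_polyConv {f : X →ₗ[ℂ] Y →ₗ[ℂ] Z} {f' : X' →ₗ[ℂ] Y' →ₗ[ℂ] Z'}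
    {a : X →ₗ[ℂ] X'} {b : Y →ₗ[ℂ] Y'} {c : Z →ₗ[ℂ] Z'} (h : ∀ x y, c (f x y) = f' (a x) (b y))
    (p : ℕ →₀ X) (q : ℕ →₀ Y) :
    polyMap c (polyConv f p q) = polyConv f' (polyMap a p) (polyMap b q) := by
  induction p using Finsupp.induction_linear with
  | zero => simp
  | add p p' h h' => 
    rw [map_add, LinearMap.add_apply, map_add, map_add, map_add, LinearMap.add_apply, h, h']
  | single i x =>
    induction q using Finsupp.induction_linear with
    | zero => simp
    | add p p' h h' => rw [map_add, map_add, map_add, map_add, h, h']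
    | single j y => simp [h]

theorem polyConv_swap {f : X →ₗ[ℂ] Y →ₗ[ℂ] Z} {f' : Y →ₗ[ℂ] X →ₗ[ℂ] Z}
    (h : ∀ x y, f x y = f' y x) (p : ℕ →₀ X) (q : ℕ →₀ Y) : polyConv f p q = polyConv f' q p := by
  induction p using Finsupp.induction_linear with
  | zero => simp
  | add p p' h h' => rw [map_add, map_add, LinearMap.add_apply, h, h']
  | single i x =>
    induction q using Finsupp.induction_linear with
    | zero => simp
    | add p p' h h' => rw [map_add, map_add, LinearMap.add_apply, h, h']
    | single j y => simp [h, add_comm]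

/-- The polynomials with coefficients in a submodule. -/
def polySub (S : Submodule ℂ X) : Submodule ℂ (ℕ →₀ X) where
  carrier := {p | ∀ n, p n ∈ S}
  add_mem' hp hq n := S.add_mem (hp n) (hq n)
  zero_mem' _ := S.zero_mem
  smul_mem' c _ hp n := S.smul_mem c (hp n)

theorem single_mem_polySub {S : Submodule ℂ X} {x : X} (h : x ∈ S) (i : ℕ) :
    Finsupp.single i x ∈ polySub S := fun n => by
  by_cases hi : i = n
  · subst hi; simpa
  · simp [hi]

theorem polyConv_mem {f : X →ₗ[ℂ] Y →ₗ[ℂ] Z} {S : Submodule ℂ Y} {T : Submodule ℂ Z}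
    (h : ∀ x, ∀ y ∈ S, f x y ∈ T) (p : ℕ →₀ X) {q : ℕ →₀ Y} (hq : q ∈ polySub S) :
    polyConv f p q ∈ polySub T :=
  Submodule.sum_mem _ fun _ _ => Submodule.sum_mem _ fun j _ =>
    single_mem_polySub (h _ _ (hq j)) _

theorem NilAct.polyConv {f : X →ₗ[ℂ] Y →ₗ[ℂ] Y} (h : NilAct f) : NilAct (polyConv f) := by
  obtain ⟨F, ⟨ha, h0⟩, h1, K, hK⟩ := h
  refine ⟨fun i => polySub (F i), ⟨fun i j hij p hp n => ha hij (hp n), ?_⟩,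
    fun i a u hu => polyConv_mem (h1 i) a hu, K, fun n hn => ?_⟩
  · simp only [h0]
    exact Submodule.eq_top_iff'.2 fun p n => Submodule.mem_top
  · simp only [hK n hn]
    exact (Submodule.eq_bot_iff _).2 fun p hp => Finsupp.ext fun n => by simpa using hp n

end Poly

section GaugePoly

theorem nexp_intertwine {V W : Type*} [AddCommGroup V] [Module ℂ V] [AddCommGroup W] [Module ℂ W]
    {f : V →ₗ[ℂ] W} {S : Module.End ℂ V} {T : Module.End ℂ W} (hS : IsNilpotent S)
    (hT : IsNilpotent T) (h : ∀ v, f (S v) = T (f v)) (v : V) : f (nexp S v) = nexp T (f v) := by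
  obtain ⟨k, hk⟩ := hS
  obtain ⟨m, hm⟩ := hT
  have hk' : S ^ (k + m) = 0 := pow_eq_zero_of_le (by omega) hk
  have hm' : T ^ (k + m) = 0 := pow_eq_zero_of_le (by omega) hm
  have hp : ∀ n u, f ((S ^ n) u) = (T ^ n) (f u) := fun n u => by
    induction n with
    | zero => rfl
    | succ n ih => rw [pow_succ', pow_succ', Module.End.mul_apply, h, ih, Module.End.mul_apply]
  rw [nexp_eq_sum (R := Module.End ℂ V) hk', nexp_eq_sum (R := Module.End ℂ W) hm',
    LinearMap.sum_apply, LinearMap.sum_apply, map_sum]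
  simp [hp]

/-- The Jacobi identity and the antisymmetry of a bracket. -/
structure IsLieBracket {G : Type*} [AddCommGroup G] [Module ℂ G] (β : G →ₗ[ℂ] G →ₗ[ℂ] G) :
    Prop where
  antisymm : ∀ a b, β a b = -β b a
  jacobi : ∀ a b c, β (β a b) c = β a (β b c) - β b (β a c)

theorem IsLieBracket.self_eq_zero {G : Type*} [AddCommGroup G] [Module ℂ G]
    {β : G →ₗ[ℂ] G →ₗ[ℂ] G} (h : IsLieBracket β) (a : G) : β a a = 0 := by
  have h2 : (2 : ℂ) • β a a = 0 := by
    rw [two_smul]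
    nth_rewrite 1 [h.antisymm]
    exact neg_add_cancel _
  exact (smul_eq_zero.1 h2).resolve_left two_ne_zero

theorem polyConv_act {A B C X Y Z W : Type*} [AddCommGroup A] [Module ℂ A] [AddCommGroup B]
    [Module ℂ B] [AddCommGroup C] [Module ℂ C] [AddCommGroup X] [Module ℂ X] [AddCommGroup Y]
    [Module ℂ Y] [AddCommGroup Z] [Module ℂ Z] [AddCommGroup W] [Module ℂ W]
    {β : A →ₗ[ℂ] B →ₗ[ℂ] C} {ρ : C →ₗ[ℂ] X →ₗ[ℂ] Y} {σ : A →ₗ[ℂ] Z →ₗ[ℂ] Y}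
    {σ' : B →ₗ[ℂ] X →ₗ[ℂ] Z} {τ : B →ₗ[ℂ] W →ₗ[ℂ] Y} {τ' : A →ₗ[ℂ] X →ₗ[ℂ] W}
    (h : ∀ a b u, ρ (β a b) u = σ a (σ' b u) - τ b (τ' a u)) (a : ℕ →₀ A) (b : ℕ →₀ B)
    (u : ℕ →₀ X) :
    polyConv ρ (polyConv β a b) u =
      polyConv σ a (polyConv σ' b u) - polyConv τ b (polyConv τ' a u) := by
  induction a using Finsupp.induction_linear with
  | zero => simp
  | add p p' h h' =>
    simp only [map_add, LinearMap.add_apply, h, h']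
    abel
  | single i x =>
    induction b using Finsupp.induction_linear with
    | zero => simp
    | add p p' h h' =>
      simp only [map_add, LinearMap.add_apply, h, h']
      abel
    | single j y =>
      induction u using Finsupp.induction_linear with
      | zero => simp
      | add p p' h h' =>
        simp only [map_add, h, h']
        abel
      | single k z => simp [h, add_assoc, add_left_comm]

theorem polyMap_polyConv_der {A B C X Y : Type*} [AddCommGroup A] [Module ℂ A] [AddCommGroup B]
    [Module ℂ B] [AddCommGroup C] [Module ℂ C] [AddCommGroup X] [Module ℂ X] [AddCommGroup Y]
    [Module ℂ Y] {W : Type*} [AddCommGroup W] [Module ℂ W] {β : A →ₗ[ℂ] B →ₗ[ℂ] C}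
    {δ : C →ₗ[ℂ] Y} {σ : A →ₗ[ℂ] X →ₗ[ℂ] Y} {d : B →ₗ[ℂ] X} {τ : B →ₗ[ℂ] W →ₗ[ℂ] Y}
    {d' : A →ₗ[ℂ] W} (h : ∀ a b, δ (β a b) = σ a (d b) - τ b (d' a)) (a : ℕ →₀ A) (b : ℕ →₀ B) :
    polyMap δ (polyConv β a b) = polyConv σ a (polyMap d b) - polyConv τ b (polyMap d' a) := by
  induction a using Finsupp.induction_linear with
  | zero => simp
  | add p p' h h' =>
    rw [map_add, LinearMap.add_apply, map_add, h, h', map_add, map_add, map_add,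
      LinearMap.add_apply]
    abel
  | single i x =>
    induction b using Finsupp.induction_linear with
    | zero => simp
    | add p p' h h' =>
      rw [map_add, map_add, h, h', map_add, map_add, map_add, LinearMap.add_apply]
      abel
    | single j y => simp [h, add_comm]

theorem IsLieBracket.polyConv {G : Type*} [AddCommGroup G] [Module ℂ G]
    {β : G →ₗ[ℂ] G →ₗ[ℂ] G} (h : IsLieBracket β) : IsLieBracket (polyConv β) where
  antisymm a b := by
    induction a using Finsupp.induction_linear with
    | zero => simp
    | add p p' h h' => rw [map_add, map_add, LinearMap.add_apply, h, h']; abel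
    | single i x =>
      induction b using Finsupp.induction_linear with
      | zero => simp
      | add p p' h h' => rw [map_add, map_add, LinearMap.add_apply, h, h']; abel
      | single j y =>
        rw [polyConv_single_single, polyConv_single_single, h.antisymm, add_comm,
          Finsupp.single_neg]
  jacobi := polyConv_act h.jacobi

namespace GaugeData

variable {G U : Type*} [AddCommGroup G] [Module ℂ G] [AddCommGroup U] [Module ℂ U]
variable (D : GaugeData G U)

/-- The coefficientwise extension of gauge data to polynomials. -/
def poly : GaugeData (ℕ →₀ G) (ℕ →₀ U) where
  br := polyConv D.br
  act := polyConv D.act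
  d := polyMap D.d
  act_br := polyConv_act D.act_br
  d_br := polyMap_polyConv_der D.d_br
  nil_br := D.nil_br.polyConv
  nil_act := D.nil_act.polyConv

/-- The gauge action on polynomials in a parameter, with the derivative in the parameter as
differential. -/
def param (hL : IsLieBracket D.br) : GaugeData (ℕ →₀ G) (ℕ →₀ G) where
  br := polyConv D.br
  act := polyConv D.br
  d := polyDeriv
  act_br := polyConv_act hL.jacobi
  d_br a b := by
    rw [polyDeriv_polyConv, hL.polyConv.antisymm (polyDeriv a) b]
    abel
  nil_br := D.nil_br.polyConv
  nil_act := D.nil_br.polyConv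

variable {D}

theorem bch_zero_zero (D : GaugeData G U) : D.bch 0 0 = 0 :=
  (D.bch_map D 0 (fun a b => by simp) 0 0).symm

theorem eval_poly_gauge (D : GaugeData G U) (c : ℂ) (a : ℕ →₀ G) (x : ℕ →₀ U) :
    polyEval c (D.poly.gauge a x) = D.gauge (polyEval c a) (polyEval c x) :=
  D.poly.gauge_map D (polyEval c) (fun u => polyEval_polyConv c D.act a u)
    (polyEval_polyMap c D.d a) x

theorem eval_param_bch (hL : IsLieBracket D.br) (c : ℂ) (a b : ℕ →₀ G) :
    polyEval c ((D.param hL).bch a b) = D.bch (polyEval c a) (polyEval c b) :=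
  (D.param hL).bch_map D (polyEval c) (fun u v => polyEval_polyConv c D.br u v) a b

theorem param_ext (hL : IsLieBracket D.br) {a b : ℕ →₀ G} (ha : polyEval 0 a = 0)
    (hb : polyEval 0 b = 0)
    (h : nexp ((D.param hL).aff a) = nexp ((D.param hL).aff b)) : a = b := by
  have h1 := nexp_injective ((D.param hL).isNilpotent_aff a) ((D.param hL).isNilpotent_aff b) h
  have h2 : polyDeriv (a - b) = 0 := by
    have := congrArg (fun f => (f ((0 : ℕ →₀ G), (1 : ℂ))).1) h1
    simp only [aff_apply, map_zero, zero_sub, one_smul, neg_inj] at this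
    rw [map_sub, sub_eq_zero]
    exact this
  have := eq_single_of_polyDeriv h2
  simpa [ha, hb, sub_eq_zero] using this

theorem bch_assoc (hL : IsLieBracket D.br) (a b c : G) :
    D.bch (D.bch a b) c = D.bch a (D.bch b c) := by
  have h : (D.param hL).bch ((D.param hL).bch (Finsupp.single 1 a) (Finsupp.single 1 b))
      (Finsupp.single 1 c) = (D.param hL).bch (Finsupp.single 1 a)
        ((D.param hL).bch (Finsupp.single 1 b) (Finsupp.single 1 c)) := by
    apply param_ext hL
    · simp [eval_param_bch, bch_zero_zero]
    · simp [eval_param_bch, bch_zero_zero]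
    · simp only [nexp_aff_bch, mul_assoc]
  simpa [eval_param_bch] using congrArg (polyEval 1) h

theorem bch_zero (hL : IsLieBracket D.br) (a : G) : D.bch a 0 = a := by
  have h : (D.param hL).bch (Finsupp.single 1 a) 0 = Finsupp.single 1 a := by
    apply param_ext hL
    · simp [eval_param_bch, bch_zero_zero]
    · simp
    · rw [nexp_aff_bch, map_zero, nexp_zero, mul_one]
  simpa [eval_param_bch] using congrArg (polyEval 1) h

theorem zero_bch (hL : IsLieBracket D.br) (a : G) : D.bch 0 a = a := by
  have h : (D.param hL).bch 0 (Finsupp.single 1 a) = Finsupp.single 1 a := by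
    apply param_ext hL
    · simp [eval_param_bch, bch_zero_zero]
    · simp
    · rw [nexp_aff_bch, map_zero, nexp_zero, one_mul]
  simpa [eval_param_bch] using congrArg (polyEval 1) h

theorem bch_neg (hL : IsLieBracket D.br) (a : G) : D.bch a (-a) = 0 := by
  have h : (D.param hL).bch (Finsupp.single 1 a) (-Finsupp.single 1 a) = 0 := by
    apply param_ext hL
    · simp [eval_param_bch, bch_zero_zero]
    · simp
    · rw [nexp_aff_bch, map_neg, nexp_mul_nexp_neg (isNilpotent_aff _ _), map_zero, nexp_zero]
  simpa [eval_param_bch] using congrArg (polyEval 1) h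

theorem neg_bch (hL : IsLieBracket D.br) (a : G) : D.bch (-a) a = 0 := by
  simpa using bch_neg hL (-a)

theorem neg_bch_cancel_left (hL : IsLieBracket D.br) (a b : G) : D.bch (-a) (D.bch a b) = b := by
  rw [← bch_assoc hL, neg_bch hL, zero_bch hL]

theorem bch_neg_cancel_left (hL : IsLieBracket D.br) (a b : G) : D.bch a (D.bch (-a) b) = b := by
  rw [← bch_assoc hL, bch_neg hL, zero_bch hL]

/-- The affine connection `∂ + α` on `U[t] × ℂ`, depending linearly on `(α, c) ↦ c ∂ + α`. -/
def connection (D : GaugeData G U) :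
    ((ℕ →₀ G) × ℂ) →ₗ[ℂ] Module.End ℂ ((ℕ →₀ U) × ℂ) :=
  D.poly.aff ∘ₗ LinearMap.fst ℂ _ ℂ +
    LinearMap.toSpanSingleton ℂ _ ((polyDeriv ∘ₗ LinearMap.fst ℂ (ℕ →₀ U) ℂ).prod 0) ∘ₗ
      LinearMap.snd ℂ _ ℂ

theorem connection_apply (α : ℕ →₀ G) (c : ℂ) (v : (ℕ →₀ U) × ℂ) :
    D.connection (α, c) v =
      (polyConv D.act α v.1 - v.2 • polyMap D.d α + c • polyDeriv v.1, 0) := by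
  simp [connection]
  rfl

theorem connection_gauge (hL : IsLieBracket D.br) (a α : ℕ →₀ G) :
    D.connection ((D.param hL).gauge a α, 1) =
      nexp (D.poly.aff a) * D.connection (α, 1) * nexp (-D.poly.aff a) := by
  rw [← nexp_aff, ← nexp_adEnd (D.poly.isNilpotent_aff a)]
  refine nexp_intertwine ((D.param hL).isNilpotent_aff a)
    (isNilpotent_adEnd (D.poly.isNilpotent_aff a)) (fun v => ?_) _
  obtain ⟨α, c⟩ := v
  refine LinearMap.ext fun w => ?_
  obtain ⟨w, e⟩ := w
  rw [aff_apply, connection_apply, adEnd_apply, LinearMap.sub_apply, Module.End.mul_apply,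
    Module.End.mul_apply, connection_apply, connection_apply, aff_apply, aff_apply]
  have e1 := D.poly.act_br a α w
  have e2 := D.poly.d_br a α
  have e3 := polyDeriv_polyConv D.act a w
  have e4 := polyDeriv_polyMap D.d a
  change polyConv D.act (polyConv D.br a α) w = polyConv D.act a (polyConv D.act α w) -
    polyConv D.act α (polyConv D.act a w) at e1
  change polyMap D.d (polyConv D.br a α) = polyConv D.act a (polyMap D.d α) -
    polyConv D.act α (polyMap D.d a) at e2
  change (polyConv D.act (polyConv D.br a α - c • polyDeriv a) w -
      e • polyMap D.d (polyConv D.br a α - c • polyDeriv a) + (0 : ℂ) • polyDeriv w, (0 : ℂ)) =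
    (polyConv D.act a (polyConv D.act α w - e • polyMap D.d α + c • polyDeriv w) -
        (0 : ℂ) • polyMap D.d a, (0 : ℂ)) -
      (polyConv D.act α (polyConv D.act a w - e • polyMap D.d a) - (0 : ℂ) • polyMap D.d α +
        c • polyDeriv (polyConv D.act a w - e • polyMap D.d a), (0 : ℂ))
  rw [Prod.mk_sub_mk, sub_zero]
  congr 1
  simp only [map_sub, map_add, map_smul, LinearMap.sub_apply, LinearMap.smul_apply, e1, e2, e3, e4,
    smul_sub, smul_add, zero_smul, smul_comm c e]
  abel

theorem connection_eq_zero_iff {α : ℕ →₀ G} {x : ℕ →₀ U} :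
    D.connection (α, 1) (x, 1) = 0 ↔ polyDeriv x = polyMap D.d α - polyConv D.act α x := by
  rw [connection_apply, Prod.mk_eq_zero, one_smul, one_smul]
  simp only [and_true]
  constructor
  · intro h
    rw [← sub_eq_zero, ← h]
    abel
  · intro h
    rw [h]
    abel

/-- Gauge transformations preserve flat sections. -/
theorem polyDeriv_gauge (hL : IsLieBracket D.br) {a α : ℕ →₀ G} {x : ℕ →₀ U}
    (h : polyDeriv x = polyMap D.d α - polyConv D.act α x) :
    polyDeriv (D.poly.gauge a x) = polyMap D.d ((D.param hL).gauge a α) -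
      polyConv D.act ((D.param hL).gauge a α) (D.poly.gauge a x) := by
  rw [← connection_eq_zero_iff] at h ⊢
  rw [connection_gauge, ← nexp_aff, ← Module.End.mul_apply, mul_assoc,
    nexp_neg_mul_nexp (D.poly.isNilpotent_aff a), mul_one, Module.End.mul_apply, h, map_zero]

/-- Every polynomial connection is gauge equivalent to the trivial one. -/
theorem exists_gauge_zero (hL : IsLieBracket D.br) (α : ℕ →₀ G) :
    ∃ a, polyEval 0 a = 0 ∧ (D.param hL).gauge a 0 = α := by
  obtain ⟨F, ⟨ha, h0⟩, h1, K, hK⟩ := D.nil_br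
  have key : ∀ i, ∃ b, polyEval 0 b = 0 ∧ (D.param hL).gauge b α ∈ polySub (F i) := fun i => by
    induction i with
    | zero => exact ⟨0, map_zero _, fun n => by simp [h0]⟩
    | succ i ih =>
      obtain ⟨b, hb0, hb⟩ := ih
      refine ⟨(D.param hL).bch (polyInt ((D.param hL).gauge b α)) b, ?_, ?_⟩
      · rw [eval_param_bch, hb0, polyEval_zero_polyInt, bch_zero_zero]
      · rw [gauge_bch]
        generalize (D.param hL).gauge b α = β at hb
        obtain ⟨m, hm⟩ := (D.param hL).gauge_eq_sum
        rw [hm (m + 1) (by omega), Finset.sum_range_succ']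
        have hact : ∀ j, ∀ q ∈ polySub (F j),
            (D.param hL).act (polyInt β) q ∈ polySub (F (j + 1)) :=
          fun j q hq => polyConv_mem (h1 j) _ hq
        have hd : (D.param hL).d (polyInt β) = β := polyDeriv_polyInt β
        have hle : polySub (F (i + 1)) ≤ polySub (F i) := fun p hp n => ha (by omega) (hp n)
        have hmem : (D.param hL).act (polyInt β) β - β ∈ polySub (F i) :=
          Submodule.sub_mem _ (hle (hact i β hb)) hb
        rw [hd]
        have e : ∀ s : ℕ →₀ G, β + (s + (((0 + 1).factorial : ℂ))⁻¹ •
            ((D.param hL).act (polyInt β) ^ 0) ((D.param hL).act (polyInt β) β - β)) =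
            s + (D.param hL).act (polyInt β) β := fun s => by
          rw [zero_add, Nat.factorial_one, Nat.cast_one, inv_one, one_smul, pow_zero,
            Module.End.one_apply]
          abel
        rw [e]
        refine Submodule.add_mem _ (Submodule.sum_mem _ fun n hn => Submodule.smul_mem _ _ ?_)
          (hact i β hb)
        clear hn
        induction n with
        | zero => simpa using hact i _ hmem
        | succ n ihn =>
          rw [pow_succ', Module.End.mul_apply]
          exact hact _ _ (hle ihn)
  obtain ⟨b, hb0, hb⟩ := key K
  refine ⟨-b, by simp [hb0], ?_⟩
  have : (D.param hL).gauge b α = 0 := Finsupp.ext fun n => by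
    have := hb n
    rwa [hK K le_rfl] at this
  rw [← this, gauge_neg_gauge]

/-- A flat section of a polynomial connection is gauge equivalent to a constant one. -/
theorem exists_gauge_const (hL : IsLieBracket D.br) {α : ℕ →₀ G} {x : ℕ →₀ U}
    (h : polyDeriv x = polyMap D.d α - polyConv D.act α x) :
    ∃ a, polyEval 0 a = 0 ∧ (D.param hL).gauge a 0 = α ∧
      D.poly.gauge a (Finsupp.single 0 (polyEval 0 x)) = x := by
  obtain ⟨a, ha, hα⟩ := exists_gauge_zero hL α
  refine ⟨a, ha, hα, ?_⟩
  have h1 := polyDeriv_gauge hL (a := -a) h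
  rw [← hα, gauge_neg_gauge] at h1
  have h2 := eq_single_of_polyDeriv (h1.trans (by simp))
  rw [eval_poly_gauge, map_neg, ha, neg_zero, gauge_zero] at h2
  rw [← h2, gauge_gauge_neg]

theorem param_gauge_single (hL : IsLieBracket D.br) (a : G) :
    (D.param hL).gauge (Finsupp.single 1 a) 0 = -Finsupp.single 0 a := by
  obtain ⟨m, hm⟩ := (D.param hL).gauge_eq_sum
  have hd : (D.param hL).d (Finsupp.single 1 a) = Finsupp.single 0 a :=
    (polyDeriv_single 1 a).trans (by simp)
  have ha : (D.param hL).act (Finsupp.single 1 a) (Finsupp.single 0 a) = 0 :=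
    (polyConv_single_single D.br 1 0 a a).trans (by rw [hL.self_eq_zero, Finsupp.single_zero])
  rw [hm (m + 1) (by omega), Finset.sum_range_succ', hd]
  simp [pow_succ, ha]

/-- The derivative of the gauge orbit `t ↦ e^{ta} * x`. -/
theorem polyDeriv_gauge_single (hL : IsLieBracket D.br) (a : G) (x : U) :
    polyDeriv (D.poly.gauge (Finsupp.single 1 a) (Finsupp.single 0 x)) =
      polyConv D.act (Finsupp.single 0 a)
        (D.poly.gauge (Finsupp.single 1 a) (Finsupp.single 0 x)) -
      Finsupp.single 0 (D.d a) := by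
  have := polyDeriv_gauge hL (a := Finsupp.single 1 a) (α := 0) (x := Finsupp.single 0 x) (D := D)
    (by simp)
  rw [this, param_gauge_single]
  simp only [map_neg, LinearMap.neg_apply, Finsupp.mapRange.linearMap_apply,
    Finsupp.mapRange_single]
  abel

end GaugeData

/-- A solution of `C' = [a, C]` vanishing at the origin vanishes. -/
theorem eq_zero_of_polyDeriv_eq {G U : Type*} [AddCommGroup G] [Module ℂ G] [AddCommGroup U]
    [Module ℂ U] {ρ : G →ₗ[ℂ] U →ₗ[ℂ] U} {a : G} {C : ℕ →₀ U}
    (h : polyDeriv C = polyConv ρ (Finsupp.single 0 a) C) (h0 : polyEval 0 C = 0) : C = 0 := by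
  refine Finsupp.ext fun n => ?_
  induction n with
  | zero =>
    have := polyInt_polyDeriv C
    have h1 : ∀ p : ℕ →₀ U, polyInt p 0 = 0 := fun p => by
      induction p using Finsupp.induction_linear with
      | zero => simp
      | add p q h h' => simp [h, h']
      | single i x => simp
    simpa [h1, h0, eq_comm] using congrArg (fun p => p 0) this
  | succ n ih =>
    have := congrArg (fun p => p n) h
    simp only [polyDeriv_apply, polyConv_single_zero_apply, ih, Finsupp.coe_zero, Pi.zero_apply,
      map_zero] at this
    exact (smul_eq_zero.1 this).resolve_left (Nat.cast_add_one_ne_zero n)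

end GaugePoly

section Slice

/-- The part of a differential graded Lie algebra in degrees `-1, 0, 1, 2` that governs
gauge transformations, with a filtration witnessing nilpotency. -/
structure LieSlice (Vm V₀ V₁ V₂ : Type*) [AddCommGroup Vm] [Module ℂ Vm] [AddCommGroup V₀]
    [Module ℂ V₀] [AddCommGroup V₁] [Module ℂ V₁] [AddCommGroup V₂] [Module ℂ V₂] where
  dm : Vm →ₗ[ℂ] V₀
  d₀ : V₀ →ₗ[ℂ] V₁
  d₁ : V₁ →ₗ[ℂ] V₂
  b00 : V₀ →ₗ[ℂ] V₀ →ₗ[ℂ] V₀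
  b0m : V₀ →ₗ[ℂ] Vm →ₗ[ℂ] Vm
  b01 : V₀ →ₗ[ℂ] V₁ →ₗ[ℂ] V₁
  b02 : V₀ →ₗ[ℂ] V₂ →ₗ[ℂ] V₂
  bm1 : Vm →ₗ[ℂ] V₁ →ₗ[ℂ] V₀
  bm2 : Vm →ₗ[ℂ] V₂ →ₗ[ℂ] V₁
  b11 : V₁ →ₗ[ℂ] V₁ →ₗ[ℂ] V₂
  isLie : IsLieBracket b00
  b01_br : ∀ a b x, b01 (b00 a b) x = b01 a (b01 b x) - b01 b (b01 a x)
  bm1_br : ∀ a r x, bm1 (b0m a r) x = b00 a (bm1 r x) - bm1 r (b01 a x)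
  b11_br : ∀ a x y, b11 (b01 a x) y = b02 a (b11 x y) - b11 x (b01 a y)
  b11_symm : ∀ x y, b11 x y = b11 y x
  bm2_b11 : ∀ c y, bm2 c (b11 y y) = (2 : ℂ) • b01 (bm1 c y) y
  d₀_br : ∀ a b, d₀ (b00 a b) = b01 a (d₀ b) - b01 b (d₀ a)
  dm_br : ∀ a r, dm (b0m a r) = b00 a (dm r) + bm1 r (d₀ a)
  d₀_bm1 : ∀ c y, d₀ (bm1 c y) = b01 (dm c) y - bm2 c (d₁ y)
  d₁_br : ∀ a x, d₁ (b01 a x) = b02 a (d₁ x) + b11 x (d₀ a)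
  d₀_dm : ∀ c, d₀ (dm c) = 0
  d₁_d₀ : ∀ a, d₁ (d₀ a) = 0
  nil : ∃ (Fm : ℕ → Submodule ℂ Vm) (F₀ : ℕ → Submodule ℂ V₀) (F₁ : ℕ → Submodule ℂ V₁),
    (Antitone Fm ∧ Antitone F₀ ∧ Antitone F₁) ∧ (Fm 0 = ⊤ ∧ F₀ 0 = ⊤ ∧ F₁ 0 = ⊤) ∧
    (∃ K, ∀ n, K ≤ n → Fm n = ⊥ ∧ F₀ n = ⊥ ∧ F₁ n = ⊥) ∧
    (∀ i a, ∀ b ∈ F₀ i, b00 a b ∈ F₀ (i + 1)) ∧ (∀ i a, ∀ r ∈ Fm i, b0m a r ∈ Fm (i + 1)) ∧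
    (∀ i r, ∀ a ∈ F₀ i, b0m a r ∈ Fm (i + 1)) ∧ (∀ i a, ∀ x ∈ F₁ i, b01 a x ∈ F₁ (i + 1)) ∧
    (∀ i r, ∀ x ∈ F₁ i, bm1 r x ∈ F₀ (i + 1))

namespace LieSlice

variable {Vm V₀ V₁ V₂ : Type*} [AddCommGroup Vm] [Module ℂ Vm] [AddCommGroup V₀]
    [Module ℂ V₀] [AddCommGroup V₁] [Module ℂ V₁] [AddCommGroup V₂] [Module ℂ V₂]
    (S : LieSlice Vm V₀ V₁ V₂)

/-- The gauge action in degrees `0` and `1`. -/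
def gd : GaugeData V₀ V₁ where
  br := S.b00
  act := S.b01
  d := S.d₀
  act_br := S.b01_br
  d_br := S.d₀_br
  nil_br := by
    obtain ⟨Fm, F₀, F₁, ⟨-, h, -⟩, ⟨-, h', -⟩, ⟨K, hK⟩, h1, -⟩ := S.nil
    exact ⟨F₀, ⟨h, h'⟩, h1, K, fun n hn => (hK n hn).2.1⟩
  nil_act := by
    obtain ⟨Fm, F₀, F₁, ⟨-, -, h⟩, ⟨-, -, h'⟩, ⟨K, hK⟩, -, -, -, h1, -⟩ := S.nil
    exact ⟨F₁, ⟨h, h'⟩, h1, K, fun n hn => (hK n hn).2.2⟩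

theorem isLieBracket_gd : IsLieBracket S.gd.br := S.isLie

theorem polySub_top {X : Type*} [AddCommGroup X] [Module ℂ X] :
    polySub (⊤ : Submodule ℂ X) = ⊤ :=
  Submodule.eq_top_iff'.2 fun _ _ => Submodule.mem_top

theorem polySub_bot {X : Type*} [AddCommGroup X] [Module ℂ X] :
    polySub (⊥ : Submodule ℂ X) = ⊥ :=
  (Submodule.eq_bot_iff _).2 fun _ hp => Finsupp.ext fun n => (Submodule.mem_bot ℂ).1 (hp n)

theorem polySub_mono {X : Type*} [AddCommGroup X] [Module ℂ X] {P Q : Submodule ℂ X} (h : P ≤ Q) :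
    polySub P ≤ polySub Q := fun _ hp n => h (hp n)

/-- The bracket on the degree zero part of polynomial differential forms. -/
def formBr : ((ℕ →₀ V₀) × (ℕ →₀ Vm)) →ₗ[ℂ] ((ℕ →₀ V₀) × (ℕ →₀ Vm)) →ₗ[ℂ]
    ((ℕ →₀ V₀) × (ℕ →₀ Vm)) :=
  LinearMap.mk₂ ℂ
    (fun p q => (polyConv S.b00 p.1 q.1, polyConv S.b0m p.1 q.2 - polyConv S.b0m q.1 p.2))
    (fun p p' q => by ext1 <;> simp; abel)
    (fun c p q => by ext1 <;> simp [smul_sub])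
    (fun p q q' => by ext1 <;> simp; abel)
    (fun c p q => by ext1 <;> simp [smul_sub])

/-- The bracket of degree zero and degree one polynomial differential forms. -/
def formAct : ((ℕ →₀ V₀) × (ℕ →₀ Vm)) →ₗ[ℂ] ((ℕ →₀ V₁) × (ℕ →₀ V₀)) →ₗ[ℂ]
    ((ℕ →₀ V₁) × (ℕ →₀ V₀)) :=
  LinearMap.mk₂ ℂ
    (fun p u => (polyConv S.b01 p.1 u.1, polyConv S.b00 p.1 u.2 - polyConv S.bm1 p.2 u.1))
    (fun p p' q => by ext1 <;> simp; abel)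
    (fun c p q => by ext1 <;> simp [smul_sub])
    (fun p q q' => by ext1 <;> simp; abel)
    (fun c p q => by ext1 <;> simp [smul_sub])

/-- The differential of polynomial differential forms of degree zero. -/
def formD : ((ℕ →₀ V₀) × (ℕ →₀ Vm)) →ₗ[ℂ] ((ℕ →₀ V₁) × (ℕ →₀ V₀)) :=
  (polyMap S.d₀ ∘ₗ LinearMap.fst ℂ _ _).prod
    (polyMap S.dm ∘ₗ LinearMap.snd ℂ _ _ + polyDeriv ∘ₗ LinearMap.fst ℂ _ _)

theorem formBr_apply (p q : (ℕ →₀ V₀) × (ℕ →₀ Vm)) : S.formBr p q =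
    (polyConv S.b00 p.1 q.1, polyConv S.b0m p.1 q.2 - polyConv S.b0m q.1 p.2) := rfl

theorem formAct_apply (p : (ℕ →₀ V₀) × (ℕ →₀ Vm)) (u : (ℕ →₀ V₁) × (ℕ →₀ V₀)) :
    S.formAct p u =
      (polyConv S.b01 p.1 u.1, polyConv S.b00 p.1 u.2 - polyConv S.bm1 p.2 u.1) := rfl

theorem formD_apply (p : (ℕ →₀ V₀) × (ℕ →₀ Vm)) :
    S.formD p = (polyMap S.d₀ p.1, polyMap S.dm p.2 + polyDeriv p.1) := rfl

/-- The gauge action on polynomial differential forms. -/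
def form : GaugeData ((ℕ →₀ V₀) × (ℕ →₀ Vm)) ((ℕ →₀ V₁) × (ℕ →₀ V₀)) where
  br := S.formBr
  act := S.formAct
  d := S.formD
  act_br a b u := by
    simp only [formBr_apply, formAct_apply, Prod.mk_sub_mk, map_sub, LinearMap.sub_apply]
    rw [polyConv_act S.b01_br, polyConv_act S.isLie.jacobi, polyConv_act S.bm1_br,
      polyConv_act S.bm1_br]
    congr 1
    abel
  d_br a b := by
    have e : ∀ a r, S.dm (S.b0m a r) = S.b00 a (S.dm r) - (-S.bm1) r (S.d₀ a) := fun a r => by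
      rw [S.dm_br, LinearMap.neg_apply, LinearMap.neg_apply, sub_neg_eq_add]
    simp only [formBr_apply, formAct_apply, formD_apply, Prod.mk_sub_mk, map_sub, map_add]
    rw [polyMap_polyConv_der S.d₀_br, polyMap_polyConv_der e, polyMap_polyConv_der e,
      polyDeriv_polyConv, S.isLie.polyConv.antisymm (polyDeriv a.1) b.1, polyConv_neg, polyConv_neg]
    congr 1
    abel
  nil_br := by
    obtain ⟨Fm, F₀, F₁, ⟨a1, a2, -⟩, ⟨t1, t2, -⟩, ⟨K, hK⟩, h1, h2, h3, -⟩ := S.nil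
    refine ⟨fun i => (polySub (F₀ i)).prod (polySub (Fm i)),
      ⟨fun i j hij => Submodule.prod_mono (polySub_mono (a2 hij)) (polySub_mono (a1 hij)), ?_⟩,
      fun i a u hu => ⟨polyConv_mem (h1 i) _ hu.1, Submodule.sub_mem _ (polyConv_mem (h2 i) _ hu.2)
        ?_⟩, K, fun n hn => ?_⟩
    · simp only [t1, t2, polySub_top, Submodule.prod_top]
    · rw [polyConv_swap (f' := S.b0m.flip) (fun x y => rfl)]
      exact polyConv_mem (h3 i) _ hu.1
    · simp only [hK n hn, polySub_bot, Submodule.prod_bot]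
  nil_act := by
    obtain ⟨Fm, F₀, F₁, ⟨-, a1, a2⟩, ⟨-, t1, t2⟩, ⟨K, hK⟩, h1, -, -, h2, h3⟩ := S.nil
    refine ⟨fun i => (polySub (F₁ i)).prod (polySub (F₀ i)),
      ⟨fun i j hij => Submodule.prod_mono (polySub_mono (a2 hij)) (polySub_mono (a1 hij)), ?_⟩,
      fun i a u hu => ⟨polyConv_mem (h2 i) _ hu.1, Submodule.sub_mem _ (polyConv_mem (h1 i) _ hu.2)
        (polyConv_mem (h3 i) _ hu.1)⟩, K, fun n hn => ?_⟩
    · simp only [t1, t2, polySub_top, Submodule.prod_top]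
    · simp only [hK n hn, polySub_bot, Submodule.prod_bot]

/-- The Maurer-Cartan equation. -/
def MC (x : V₁) : Prop := S.d₁ x + (2 : ℂ)⁻¹ • S.b11 x x = 0

/-- The Maurer-Cartan equation for polynomial differential forms. -/
def FormMC (u : (ℕ →₀ V₁) × (ℕ →₀ V₀)) : Prop :=
  polyMap S.d₁ u.1 + (2 : ℂ)⁻¹ • polyConv S.b11 u.1 u.1 = 0 ∧
    polyDeriv u.1 = polyMap S.d₀ u.2 - polyConv S.b01 u.2 u.1

/-- Degree one elements as constant forms. -/
def const₁ : V₁ →ₗ[ℂ] (ℕ →₀ V₁) × (ℕ →₀ V₀) := LinearMap.inl ℂ _ _ ∘ₗ Finsupp.lsingle 0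

/-- Degree zero elements as constant forms. -/
def const₀ : V₀ →ₗ[ℂ] (ℕ →₀ V₀) × (ℕ →₀ Vm) := LinearMap.inl ℂ _ _ ∘ₗ Finsupp.lsingle 0

theorem form_gauge_const (p : V₀) (x : V₁) :
    S.form.gauge (const₀ p) (const₁ x) = const₁ (S.gd.gauge p x) := by
  refine (S.gd.gauge_map S.form const₁ (fun u => ?_) ?_ x).symm
  · refine (Prod.ext ?_ ?_ : _ = S.formAct _ _) <;> simp [formAct_apply, const₁, const₀, gd]
  · refine (Prod.ext ?_ ?_ : _ = S.formD _) <;> simp [formD_apply, const₁, const₀, gd]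

theorem form_gauge (a : ℕ →₀ V₀) (x : ℕ →₀ V₁) (α : ℕ →₀ V₀) :
    S.form.gauge (a, 0) (x, α) =
      (S.gd.poly.gauge a x, (S.gd.param S.isLieBracket_gd).gauge a α) := by
  refine Prod.ext ?_ ?_
  · exact S.form.gauge_map S.gd.poly (LinearMap.fst ℂ _ _) (a := (a, 0)) (a' := a)
      (fun u => rfl) rfl (x, α)
  · refine S.form.gauge_map (S.gd.param S.isLieBracket_gd) (LinearMap.snd ℂ _ _)
      (a := (a, 0)) (a' := a)
      (fun u => ?_) ?_ (x, α)
    · change polyConv S.b00 a u.2 - polyConv S.bm1 0 u.1 = polyConv S.b00 a u.2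
      simp
    · change polyMap S.dm 0 + polyDeriv a = polyDeriv a
      simp

theorem formMC_gauge {x : V₁} (hx : S.MC x) (a : V₀) :
    S.FormMC (S.form.gauge (Finsupp.single 1 a, 0) (const₁ x)) := by
  have hc : (const₁ x : (ℕ →₀ V₁) × (ℕ →₀ V₀)) = (Finsupp.single 0 x, 0) := rfl
  rw [hc, form_gauge, GaugeData.param_gauge_single]
  have hd := GaugeData.polyDeriv_gauge_single (D := S.gd) S.isLieBracket_gd a x
  have he := S.gd.eval_poly_gauge 0 (Finsupp.single 1 a) (Finsupp.single 0 x)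
  rw [polyEval_single, polyEval_single, pow_one, zero_smul, pow_zero, one_smul,
    GaugeData.gauge_zero] at he
  generalize S.gd.poly.gauge (Finsupp.single 1 a) (Finsupp.single 0 x) = y at hd he
  change polyDeriv y = polyConv S.b01 (Finsupp.single 0 a) y - Finsupp.single 0 (S.d₀ a) at hd
  refine ⟨?_, ?_⟩
  · refine eq_zero_of_polyDeriv_eq (ρ := S.b02) (a := a) ?_ ?_
    · dsimp only
      have e1 : polyMap S.d₁ (polyConv S.b01 (Finsupp.single 0 a) y) =
          polyConv S.b02 (Finsupp.single 0 a) (polyMap S.d₁ y) +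
            polyConv S.b11 y (Finsupp.single 0 (S.d₀ a)) := by
        have e : ∀ a x, S.d₁ (S.b01 a x) = S.b02 a (S.d₁ x) - S.b11 x ((-S.d₀) a) := fun a x => by
          rw [S.d₁_br, LinearMap.neg_apply, map_neg, sub_neg_eq_add]
        rw [polyMap_polyConv_der e]
        simp
      have e2 := polyConv_act S.b11_br (Finsupp.single 0 a) y y
      have e3 : ∀ z, polyConv S.b11 y z = polyConv S.b11 z y := fun z =>
        polyConv_swap S.b11_symm y z
      have e4 : polyConv S.b02 (Finsupp.single 0 a) (polyConv S.b11 y y) =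
          (2 : ℂ) • polyConv S.b11 (polyConv S.b01 (Finsupp.single 0 a) y) y := by
        rw [two_smul]
        nth_rewrite 1 [e2]
        rw [e3 (polyConv S.b01 (Finsupp.single 0 a) y)]
        abel
      rw [map_add, map_smul, polyDeriv_polyConv, polyDeriv_polyMap, e3 (polyDeriv y), ← two_smul ℂ,
        smul_smul, inv_mul_cancel₀ two_ne_zero, one_smul, hd, map_sub, map_sub, e1, map_add,
        map_smul, e4, smul_smul, inv_mul_cancel₀ two_ne_zero, one_smul, e3]
      simp [S.d₁_d₀]
    · rw [map_add, map_smul, polyEval_polyMap, polyEval_polyConv, he]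
      exact hx
  · rw [hd]
    dsimp only
    rw [map_neg, map_neg, LinearMap.neg_apply, sub_neg_eq_add]
    simp
    abel

theorem exists_gauge_of_formMC {u : (ℕ →₀ V₁) × (ℕ →₀ V₀)} (hu : S.FormMC u) :
    ∃ a, polyEval 0 a = 0 ∧ S.form.gauge (a, 0) (const₁ (polyEval 0 u.1)) = u := by
  obtain ⟨a, h0, h1, h2⟩ := GaugeData.exists_gauge_const (D := S.gd) S.isLieBracket_gd hu.2
  exact ⟨a, h0, (S.form_gauge _ _ _).trans (Prod.ext h2 h1)⟩

/-- The stabilizer element `dc + [y, c]` of a Maurer-Cartan element `y`. -/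
def stab (y : V₁) (c : Vm) : V₀ := S.dm c + S.bm1 c y

theorem b01_stab {y : V₁} (hy : S.MC y) (c : Vm) : S.b01 (S.stab y c) y = S.d₀ (S.stab y c) := by
  have h : S.d₁ y = -((2 : ℂ)⁻¹ • S.b11 y y) := eq_neg_of_add_eq_zero_left hy
  rw [stab, map_add, map_add, LinearMap.add_apply, S.d₀_dm, S.d₀_bm1, h, map_neg, map_smul,
    S.bm2_b11, smul_smul, inv_mul_cancel₀ two_ne_zero, one_smul]
  abel

theorem form_gauge_stab {y : V₁} (hy : S.MC y) (c : Vm) :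
    S.form.gauge (Finsupp.single 1 (S.stab y c), -Finsupp.single 0 c) (const₁ y) = const₁ y := by
  rw [GaugeData.gauge_eq_self_iff]
  change S.formAct _ _ = S.formD _
  refine Prod.ext ?_ ?_
  · simp [formAct_apply, formD_apply, const₁, S.b01_stab hy]
  · change polyConv S.b00 _ 0 - polyConv S.bm1 (-Finsupp.single 0 c) (Finsupp.single 0 y) =
      polyMap S.dm (-Finsupp.single 0 c) + polyDeriv (Finsupp.single 1 (S.stab y c))
    rw [map_neg, map_neg]
    simp [stab]

theorem exists_stab {y : V₁} {ν : (ℕ →₀ V₀) × (ℕ →₀ Vm)} (h0 : polyEval 0 ν.1 = 0)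
    (h : S.form.gauge ν (const₁ y) = const₁ y) : ∃ c, polyEval 1 ν.1 = S.stab y c := by
  rw [GaugeData.gauge_eq_self_iff] at h
  have h2 : polyConv S.b00 ν.1 0 - polyConv S.bm1 ν.2 (Finsupp.single 0 y) =
    polyMap S.dm ν.2 + polyDeriv ν.1 := congrArg Prod.snd h
  have h3 : polyConv S.bm1 ν.2 (Finsupp.single 0 y) = polyMap (S.bm1.flip y) ν.2 := by
    generalize ν.2 = p
    induction p using Finsupp.induction_linear with
    | zero => simp
    | add p q h h' => rw [map_add, LinearMap.add_apply, h, h', map_add]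
    | single i x => simp
  have h4 : polyDeriv ν.1 = polyMap (-(S.dm + S.bm1.flip y)) ν.2 := by
    have : polyMap (-(S.dm + S.bm1.flip y)) ν.2 =
        -(polyMap S.dm ν.2 + polyMap (S.bm1.flip y) ν.2) := by
      ext n
      simp
    rw [map_zero, zero_sub, h3] at h2
    rw [this, neg_add_rev, h2]
    abel
  have h5 : polyInt (polyMap (-(S.dm + S.bm1.flip y)) ν.2) =
      polyMap (-(S.dm + S.bm1.flip y)) (polyInt ν.2) := by
    generalize ν.2 = p
    induction p using Finsupp.induction_linear with
    | zero => simp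
    | add p q h h' => rw [map_add, map_add, h, h', map_add, map_add]
    | single i x => simp
  have h6 := polyInt_polyDeriv ν.1
  rw [h0, Finsupp.single_zero, sub_zero, h4, h5] at h6
  refine ⟨-polyEval 1 (polyInt ν.2), ?_⟩
  rw [← h6, polyEval_polyMap, stab]
  simp [add_comm]

end LieSlice

end Slice

section Homotopy

/-- A morphism of slices in degrees zero and one. -/
structure SliceHom {Vm V₀ V₁ V₂ Wm W₀ W₁ W₂ : Type*} [AddCommGroup Vm] [Module ℂ Vm]
    [AddCommGroup V₀] [Module ℂ V₀] [AddCommGroup V₁] [Module ℂ V₁] [AddCommGroup V₂]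
    [Module ℂ V₂] [AddCommGroup Wm] [Module ℂ Wm] [AddCommGroup W₀] [Module ℂ W₀]
    [AddCommGroup W₁] [Module ℂ W₁] [AddCommGroup W₂] [Module ℂ W₂]
    (S : LieSlice Vm V₀ V₁ V₂) (T : LieSlice Wm W₀ W₁ W₂) where
  f₀ : V₀ →ₗ[ℂ] W₀
  f₁ : V₁ →ₗ[ℂ] W₁
  map_b00 : ∀ a b, f₀ (S.b00 a b) = T.b00 (f₀ a) (f₀ b)
  map_b01 : ∀ a x, f₁ (S.b01 a x) = T.b01 (f₀ a) (f₁ x)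
  map_d₀ : ∀ a, f₁ (S.d₀ a) = T.d₀ (f₀ a)
  map_MC : ∀ x, S.MC x → T.MC (f₁ x)

namespace SliceHom

variable {Vm V₀ V₁ V₂ Wm W₀ W₁ W₂ : Type*} [AddCommGroup Vm] [Module ℂ Vm]
    [AddCommGroup V₀] [Module ℂ V₀] [AddCommGroup V₁] [Module ℂ V₁] [AddCommGroup V₂]
    [Module ℂ V₂] [AddCommGroup Wm] [Module ℂ Wm] [AddCommGroup W₀] [Module ℂ W₀]
    [AddCommGroup W₁] [Module ℂ W₁] [AddCommGroup W₂] [Module ℂ W₂]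
    {S : LieSlice Vm V₀ V₁ V₂} {T : LieSlice Wm W₀ W₁ W₂} (f : SliceHom S T)

/-- The action of a morphism on polynomial differential forms of degree one. -/
def form : ((ℕ →₀ V₁) × (ℕ →₀ V₀)) →ₗ[ℂ] ((ℕ →₀ W₁) × (ℕ →₀ W₀)) :=
  (polyMap f.f₁).prodMap (polyMap f.f₀)

theorem form_apply (u : (ℕ →₀ V₁) × (ℕ →₀ V₀)) :
    f.form u = (polyMap f.f₁ u.1, polyMap f.f₀ u.2) := rfl

@[simp] theorem form_const (x : V₁) : f.form (LieSlice.const₁ x) = LieSlice.const₁ (f.f₁ x) := by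
  refine Prod.ext ?_ ?_ <;> simp [form_apply, LieSlice.const₁]

theorem form_gauge (a : ℕ →₀ V₀) (u : (ℕ →₀ V₁) × (ℕ →₀ V₀)) :
    f.form (S.form.gauge (a, 0) u) = T.form.gauge (polyMap f.f₀ a, 0) (f.form u) := by
  refine S.form.gauge_map T.form f.form (fun u => ?_) ?_ u
  · change f.form (S.formAct _ _) = T.formAct _ _
    refine Prod.ext ?_ ?_
    · exact polyMap_polyConv f.map_b01 _ _
    · simp only [form_apply, S.formAct_apply, T.formAct_apply, map_zero, LinearMap.zero_apply,
        sub_zero]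
      exact polyMap_polyConv f.map_b00 _ _
  · change f.form (S.formD _) = T.formD _
    refine Prod.ext ?_ ?_
    · simp only [form_apply, S.formD_apply, T.formD_apply]
      ext n
      simp [f.map_d₀]
    · simp only [form_apply, S.formD_apply, T.formD_apply, map_zero, zero_add]
      exact (polyDeriv_polyMap _ _).symm

end SliceHom

namespace LieSlice

section

variable {Vm V₀ V₁ V₂ : Type*} [AddCommGroup Vm] [Module ℂ Vm] [AddCommGroup V₀]
    [Module ℂ V₀] [AddCommGroup V₁] [Module ℂ V₁] [AddCommGroup V₂] [Module ℂ V₂]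
    (S : LieSlice Vm V₀ V₁ V₂)

theorem eval_form_bch (c : ℂ) (u v : (ℕ →₀ V₀) × (ℕ →₀ Vm)) :
    polyEval c (S.form.bch u v).1 = S.gd.bch (polyEval c u.1) (polyEval c v.1) :=
  S.form.bch_map S.gd (polyEval c ∘ₗ LinearMap.fst ℂ _ _)
    (fun u v => polyEval_polyConv c S.b00 u.1 v.1) u v

theorem eval_form_gauge (c : ℂ) (a : (ℕ →₀ V₀)) (u : (ℕ →₀ V₁) × (ℕ →₀ V₀)) :
    polyEval c (S.form.gauge (a, 0) u).1 = S.gd.gauge (polyEval c a) (polyEval c u.1) := by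
  rw [S.form_gauge a u.1 u.2, S.gd.eval_poly_gauge]

end

variable {Lm L₀ L₁ L₂ Mm M₀ M₁ M₂ Nm N₀ N₁ N₂ : Type*}
    [AddCommGroup Lm] [Module ℂ Lm] [AddCommGroup L₀] [Module ℂ L₀] [AddCommGroup L₁]
    [Module ℂ L₁] [AddCommGroup L₂] [Module ℂ L₂]
    [AddCommGroup Mm] [Module ℂ Mm] [AddCommGroup M₀] [Module ℂ M₀] [AddCommGroup M₁]
    [Module ℂ M₁] [AddCommGroup M₂] [Module ℂ M₂]
    [AddCommGroup Nm] [Module ℂ Nm] [AddCommGroup N₀] [Module ℂ N₀] [AddCommGroup N₁]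
    [Module ℂ N₁] [AddCommGroup N₂] [Module ℂ N₂]
    {SL : LieSlice Lm L₀ L₁ L₂} {SM : LieSlice Mm M₀ M₁ M₂} {SN : LieSlice Nm N₀ N₁ N₂}
    (h : SliceHom SL SM) (g : SliceHom SN SM)

theorem exists_homotopy {x : L₁} {y : N₁} {p : M₀} (hx : SL.MC x) (hy : SN.MC y)
    (hp : g.f₁ y = SM.gd.gauge p (h.f₁ x)) (a : L₀) (b : N₀) (c : Mm) :
    ∃ (l : (ℕ →₀ L₁) × (ℕ →₀ L₀)) (n : (ℕ →₀ N₁) × (ℕ →₀ N₀)) (m : (ℕ →₀ M₀) × (ℕ →₀ Mm)),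
      SL.FormMC l ∧ SN.FormMC n ∧ g.form n = SM.form.gauge m (h.form l) ∧
      polyEval 0 l.1 = x ∧ polyEval 0 n.1 = y ∧ polyEval 0 m.1 = p ∧
      polyEval 1 l.1 = SL.gd.gauge a x ∧ polyEval 1 n.1 = SN.gd.gauge b y ∧
      polyEval 1 m.1 = SM.gd.bch (g.f₀ b)
        (SM.gd.bch (SM.stab (g.f₁ y) c) (SM.gd.bch p (-h.f₀ a))) := by
  refine ⟨_, _, SM.form.bch (Finsupp.single 1 (g.f₀ b), 0) (SM.form.bch
    (Finsupp.single 1 (SM.stab (g.f₁ y) c), -Finsupp.single 0 c)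
    (SM.form.bch (const₀ p) (-(Finsupp.single 1 (h.f₀ a), 0)))),
    SL.formMC_gauge hx a, SN.formMC_gauge hy b, ?_, ?_, ?_, ?_, ?_, ?_, ?_⟩
  · rw [g.form_gauge, h.form_gauge, g.form_const, h.form_const, polyMap_single,
      polyMap_single, SM.form.gauge_bch,
      SM.form.gauge_bch, SM.form.gauge_bch, SM.form.gauge_neg_gauge, SM.form_gauge_const, ← hp,
      SM.form_gauge_stab (g.map_MC y hy)]
  all_goals
    simp [eval_form_gauge, eval_form_bch, const₀, const₁, GaugeData.zero_bch SM.isLieBracket_gd,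
      GaugeData.bch_zero SM.isLieBracket_gd]

theorem exists_gauge_of_homotopy {l : (ℕ →₀ L₁) × (ℕ →₀ L₀)} {n : (ℕ →₀ N₁) × (ℕ →₀ N₀)}
    {m : (ℕ →₀ M₀) × (ℕ →₀ Mm)} (hl : SL.FormMC l) (hn : SN.FormMC n)
    (hm : g.form n = SM.form.gauge m (h.form l))
    (hp : g.f₁ (polyEval 0 n.1) = SM.gd.gauge (polyEval 0 m.1) (h.f₁ (polyEval 0 l.1))) :
    ∃ a b c, polyEval 1 l.1 = SL.gd.gauge a (polyEval 0 l.1) ∧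
      polyEval 1 n.1 = SN.gd.gauge b (polyEval 0 n.1) ∧
      polyEval 1 m.1 = SM.gd.bch (g.f₀ b) (SM.gd.bch (SM.stab (g.f₁ (polyEval 0 n.1)) c)
        (SM.gd.bch (polyEval 0 m.1) (-h.f₀ a))) := by
  obtain ⟨a, ha, hla⟩ := SL.exists_gauge_of_formMC hl
  obtain ⟨b, hb, hnb⟩ := SN.exists_gauge_of_formMC hn
  have hν : SM.form.gauge (SM.form.bch (-(polyMap g.f₀ b, 0)) (SM.form.bch m
      (SM.form.bch (polyMap h.f₀ a, 0) (-const₀ (polyEval 0 m.1)))))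
      (const₁ (g.f₁ (polyEval 0 n.1))) = const₁ (g.f₁ (polyEval 0 n.1)) := by
    rw [SM.form.gauge_bch, SM.form.gauge_bch, SM.form.gauge_bch]
    nth_rewrite 1 [hp]
    rw [← SM.form_gauge_const, SM.form.gauge_neg_gauge, ← h.form_const, ← h.form_gauge, hla, ← hm]
    nth_rewrite 1 [← hnb]
    rw [g.form_gauge, SM.form.gauge_neg_gauge, g.form_const]
  obtain ⟨c, hc⟩ := SM.exists_stab (by
    simp [-Finsupp.mapRange.linearMap_apply, eval_form_bch, const₀, ha, hb,
      GaugeData.zero_bch SM.isLieBracket_gd,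
      GaugeData.bch_neg SM.isLieBracket_gd]) hν
  refine ⟨polyEval 1 a, polyEval 1 b, c, ?_, ?_, ?_⟩
  · conv_lhs => rw [← hla]
    simp [eval_form_gauge, const₁]
  · conv_lhs => rw [← hnb]
    simp [eval_form_gauge, const₁]
  · rw [← hc]
    simp [-Finsupp.mapRange.linearMap_apply, eval_form_bch, const₀,
      GaugeData.bch_assoc SM.isLieBracket_gd,
      GaugeData.neg_bch_cancel_left SM.isLieBracket_gd,
      GaugeData.bch_neg_cancel_left SM.isLieBracket_gd, GaugeData.bch_zero SM.isLieBracket_gd,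
      GaugeData.bch_neg SM.isLieBracket_gd]

end LieSlice

end Homotopy

section Tensor

namespace GLD

variable (L : GLD)

theorem tr_add {i j : ℤ} (h : i = j) (x y : L.V i) : L.tr h (x + y) = L.tr h x + L.tr h y := by
  subst h; rfl

theorem tr_zero {i j : ℤ} (h : i = j) : L.tr h (0 : L.V i) = 0 := by
  subst h; rfl

theorem tr_zsmul {i j : ℤ} (h : i = j) (n : ℤ) (x : L.V i) : L.tr h (n • x) = n • L.tr h x := by
  subst h; rfl

theorem tr_neg {i j : ℤ} (h : i = j) (x : L.V i) : L.tr h (-x) = -L.tr h x := by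
  subst h; rfl

theorem tr_tr {i j k : ℤ} (h : i = j) (h' : j = k) (x : L.V i) :
    L.tr h' (L.tr h x) = L.tr (h.trans h') x := by
  subst h; rfl

end GLD

namespace DGLA

variable (L : DGLA) (A : Type) [CommRing A] [Algebra ℂ A] [IsLocalRing A]

variable {A} in
/-- Pure tensors in `L ⊗ m_A`. -/
def tenMk {i : ℤ} (x : L.V i) (a : mA A) : (L.ten A).V i := x ⊗ₜ a

theorem ten_induction {i : ℤ} {P : (L.ten A).V i → Prop} (x : (L.ten A).V i) (zero : P 0)
    (add : ∀ x y, P x → P y → P (x + y)) (tmul : ∀ x a, P (L.tenMk x a)) : P x :=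
  TensorProduct.induction_on (motive := P) x zero tmul add

theorem tenMk_add {i : ℤ} (x y : L.V i) (a : mA A) :
    L.tenMk (x + y) a = L.tenMk x a + L.tenMk y a :=
  TensorProduct.add_tmul x y a

theorem tenMk_zero {i : ℤ} (a : mA A) : L.tenMk (0 : L.V i) a = 0 :=
  TensorProduct.zero_tmul _ a

theorem tenMk_neg {i : ℤ} (x : L.V i) (a : mA A) : L.tenMk (-x) a = -L.tenMk x a :=
  TensorProduct.neg_tmul x a

theorem tenMk_zsmul {i : ℤ} (n : ℤ) (x : L.V i) (a : mA A) :
    L.tenMk (n • x) a = n • L.tenMk x a :=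
  map_zsmul ((TensorProduct.mk ℂ (L.V i) (mA A)).flip a) n x

theorem ten_d_tmul (i : ℤ) (x : L.V i) (a : mA A) :
    (L.ten A).d i (L.tenMk x a) = L.tenMk (L.d i x) a := rfl

theorem ten_br_tmul (i j : ℤ) (x : L.V i) (y : L.V j) (a b : mA A) :
    (L.ten A).br i j (L.tenMk x a) (L.tenMk y b) = L.tenMk (L.br i j x y) (mMul A a b) := rfl

theorem ten_tr_tmul {i j : ℤ} (h : i = j) (x : L.V i) (a : mA A) :
    (L.ten A).tr h (L.tenMk x a) = L.tenMk (L.tr h x) a := by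
  subst h; rfl

theorem ten_d_add (i : ℤ) (x y : (L.ten A).V i) :
    (L.ten A).d i (x + y) = (L.ten A).d i x + (L.ten A).d i y :=
  map_add (LinearMap.rTensor (mA A) (L.dLin i)) x y

theorem ten_d_zero (i : ℤ) : (L.ten A).d i 0 = 0 :=
  map_zero (LinearMap.rTensor (mA A) (L.dLin i))

/-- The bracket on `L ⊗ m_A` as a bilinear map. -/
def tenBr (i j : ℤ) : (L.ten A).V i →ₗ[ℂ] (L.ten A).V j →ₗ[ℂ] (L.ten A).V (i + j) :=
  TensorProduct.curry
    ((TensorProduct.map (TensorProduct.lift (L.brLin i j)) (TensorProduct.lift (mMul A)))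
      ∘ₗ (TensorProduct.tensorTensorTensorComm ℂ (L.V i) (mA A) (L.V j) (mA A)).toLinearMap)

theorem ten_br_add_left (i j : ℤ) (x x' : (L.ten A).V i) (y : (L.ten A).V j) :
    (L.ten A).br i j (x + x') y = (L.ten A).br i j x y + (L.ten A).br i j x' y :=
  (L.tenBr A i j).map_add₂ x x' y

theorem ten_br_zero_left (i j : ℤ) (y : (L.ten A).V j) : (L.ten A).br i j 0 y = 0 :=
  (L.tenBr A i j).map_zero₂ y

theorem ten_br_add_right (i j : ℤ) (x : (L.ten A).V i) (y y' : (L.ten A).V j) :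
    (L.ten A).br i j x (y + y') = (L.ten A).br i j x y + (L.ten A).br i j x y' :=
  map_add (L.tenBr A i j x) y y'

theorem ten_br_zero_right (i j : ℤ) (x : (L.ten A).V i) : (L.ten A).br i j x 0 = 0 :=
  map_zero (L.tenBr A i j x)

theorem mMul_comm (a b : mA A) : mMul A a b = mMul A b a := Subtype.ext (mul_comm a.1 b.1)

theorem mMul_assoc (a b c : mA A) : mMul A (mMul A a b) c = mMul A a (mMul A b c) :=
  Subtype.ext (mul_assoc a.1 b.1 c.1)

theorem mMul_left_comm (a b c : mA A) : mMul A a (mMul A b c) = mMul A b (mMul A a c) :=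
  Subtype.ext (mul_left_comm a.1 b.1 c.1)

/-- The tensor product `L ⊗ m_A` as a differential graded Lie algebra. -/
def tensor : DGLA where
  toGLD := L.ten A
  d_add := L.ten_d_add A
  d_smul i c x := map_smul (LinearMap.rTensor (mA A) (L.dLin i)) c x
  br_add_left := L.ten_br_add_left A
  br_smul_left i j c x y := (L.tenBr A i j).map_smul₂ c x y
  br_add_right := L.ten_br_add_right A
  br_smul_right i j c x y := map_smul (L.tenBr A i j x) c y
  d_sq i x := by
    induction x using ten_induction with
    | zero => rw [ten_d_zero, ten_d_zero]
    | add x y hx hy => rw [ten_d_add, ten_d_add, hx, hy, add_zero]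
    | tmul x a => rw [ten_d_tmul, ten_d_tmul, L.d_sq, tenMk_zero]
  antisym i j x y := by
    induction x using ten_induction with
    | zero => rw [ten_br_zero_left, ten_br_zero_right, smul_zero, GLD.tr_zero, neg_zero]
    | add x x' hx hx' =>
      rw [ten_br_add_left, hx, hx', ten_br_add_right, smul_add, GLD.tr_add, neg_add]
    | tmul x a =>
      induction y using ten_induction with
      | zero => rw [ten_br_zero_left, ten_br_zero_right, smul_zero, GLD.tr_zero, neg_zero]
      | add x x' hx hx' =>
        rw [ten_br_add_right, hx, hx', ten_br_add_left, smul_add, GLD.tr_add, neg_add]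
      | tmul y b =>
        rw [ten_br_tmul, ten_br_tmul, GLD.tr_zsmul, ten_tr_tmul, L.antisym, GLD.tr_zsmul,
          tenMk_neg, tenMk_zsmul, mMul_comm]
  leibniz i j x y := by
    induction x using ten_induction with
    | zero => simp only [ten_br_zero_left, ten_d_zero, GLD.tr_zero, smul_zero, add_zero]
    | add x x' hx hx' =>
      simp only [ten_br_add_left, ten_d_add, GLD.tr_add, smul_add, hx, hx']
      exact add_add_add_comm _ _ _ _
    | tmul x a =>
      induction y using ten_induction with
      | zero => simp only [ten_br_zero_right, ten_d_zero, GLD.tr_zero, smul_zero, add_zero]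
      | add x x' hx hx' =>
        simp only [ten_br_add_right, ten_d_add, GLD.tr_add, smul_add, hx, hx']
        exact add_add_add_comm _ _ _ _
      | tmul y b =>
        rw [ten_br_tmul, ten_d_tmul, ten_d_tmul, ten_d_tmul, ten_br_tmul, ten_br_tmul, ten_tr_tmul,
          ten_tr_tmul, L.leibniz, tenMk_add, tenMk_zsmul]
  jacobi i j k x y z := by
    induction x using ten_induction with
    | zero => simp only [ten_br_zero_left, ten_br_zero_right, GLD.tr_zero, smul_zero, add_zero]
    | add x x' hx hx' =>
      simp only [ten_br_add_left, ten_br_add_right, GLD.tr_add, smul_add, hx, hx']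
      exact add_add_add_comm _ _ _ _
    | tmul x a =>
      induction y using ten_induction with
      | zero => simp only [ten_br_zero_left, ten_br_zero_right, GLD.tr_zero, smul_zero, add_zero]
      | add x x' hx hx' =>
        simp only [ten_br_add_left, ten_br_add_right, GLD.tr_add, smul_add, hx, hx']
        exact add_add_add_comm _ _ _ _
      | tmul y b =>
        induction z using ten_induction with
        | zero => simp only [ten_br_zero_right, GLD.tr_zero, smul_zero, add_zero]
        | add x x' hx hx' =>
          simp only [ten_br_add_right, GLD.tr_add, smul_add, hx, hx']
          exact add_add_add_comm _ _ _ _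
        | tmul z c =>
          rw [ten_br_tmul, ten_br_tmul, ten_br_tmul, ten_br_tmul, ten_br_tmul, ten_br_tmul,
            ten_tr_tmul, ten_tr_tmul, L.jacobi, tenMk_add, tenMk_zsmul, mMul_assoc,
            mMul_left_comm A b]

end DGLA

end Tensor

section SliceOfDGLA

namespace DGLA

/-- A filtration of a differential graded Lie algebra that is strictly raised by brackets and
eventually zero. -/
def NilFiltered (W : DGLA) : Prop :=
  ∃ F : ∀ n, ℕ → Submodule ℂ (W.V n), (∀ n, Antitone (F n)) ∧ (∀ n, F n 0 = ⊤) ∧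
    (∃ K, ∀ n k, K ≤ k → F n k = ⊥) ∧
    (∀ i j k a, ∀ b ∈ F j k, W.br i j a b ∈ F (i + j) (k + 1)) ∧
    (∀ i j k b, ∀ a ∈ F i k, W.br i j a b ∈ F (i + j) (k + 1))

theorem nilFiltered_tensor (L : DGLA) (A : Type) [CommRing A] [Algebra ℂ A] [IsLocalRing A]
    [IsArtinianRing A] : (L.tensor A).NilFiltered := by
  let F : ∀ n, ℕ → Submodule ℂ ((L.tensor A).V n) := fun n k =>
    Submodule.span ℂ {w | ∃ (x : L.V n) (a : mA A), (a : A) ∈ mA A ^ (k + 1) ∧ L.tenMk x a = w}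
  have hmul : ∀ (k : ℕ) (a b : mA A), (b : A) ∈ mA A ^ (k + 1) →
      (mMul A a b : A) ∈ mA A ^ (k + 1 + 1) := fun k a b hb => by
    rw [pow_succ']
    exact Ideal.mul_mem_mul a.2 hb
  refine ⟨F, fun n k l h => Submodule.span_mono ?_, fun n => ?_, ?_, fun i j k a b hb => ?_,
    fun i j k b a ha => ?_⟩
  · rintro _ ⟨x, a, ha, rfl⟩
    exact ⟨x, a, Ideal.pow_le_pow_right (by omega) ha, rfl⟩
  · refine Submodule.eq_top_iff'.2 fun w => ?_
    refine L.ten_induction A w (zero_mem _) (fun x y => add_mem) fun x a =>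
      Submodule.subset_span ⟨x, a, ?_, rfl⟩
    rw [zero_add, pow_one]
    exact a.2
  · obtain ⟨K, hK⟩ := IsArtinianRing.isNilpotent_jacobson_bot (R := A)
    rw [IsLocalRing.jacobson_eq_maximalIdeal ⊥ bot_ne_top] at hK
    refine ⟨K, fun n k hk => ?_⟩
    rw [Submodule.span_eq_bot]
    rintro _ ⟨x, a, ha, rfl⟩
    have h0 : (a : A) ∈ mA A ^ K := Ideal.pow_le_pow_right (by omega) ha
    rw [hK] at h0
    have h1 : a = 0 := Subtype.ext h0
    rw [h1]
    exact TensorProduct.tmul_zero _ x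
  · refine Submodule.span_induction (p := fun b _ => (L.tensor A).br i j a b ∈ F (i + j) (k + 1))
      ?_ ?_ (fun b b' _ _ h h' => ?_) (fun c b _ h => ?_) hb
    · rintro _ ⟨y, b, hb, rfl⟩
      refine L.ten_induction A (P := fun a => (L.tensor A).br i j a _ ∈ F (i + j) (k + 1))
        a ?_ (fun x x' h h' => ?_) fun x a => ?_
      · exact (L.ten_br_zero_left A i j _).symm ▸ zero_mem _
      · exact (L.ten_br_add_left A i j _ _ _).symm ▸ add_mem h h'
      · exact Submodule.subset_span ⟨_, _, hmul k a b hb, rfl⟩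
    · exact (L.ten_br_zero_right A i j _).symm ▸ zero_mem _
    · exact (L.ten_br_add_right A i j _ _ _).symm ▸ add_mem h h'
    · exact ((L.tensor A).br_smul_right i j c a b).symm ▸ Submodule.smul_mem _ c h
  · refine Submodule.span_induction (p := fun a _ => (L.tensor A).br i j a b ∈ F (i + j) (k + 1))
      ?_ ?_ (fun b b' _ _ h h' => ?_) (fun c b _ h => ?_) ha
    · rintro _ ⟨y, a, ha, rfl⟩
      refine L.ten_induction A (P := fun b => (L.tensor A).br i j _ b ∈ F (i + j) (k + 1))
        b ?_ (fun x x' h h' => ?_) fun x b => ?_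
      · exact (L.ten_br_zero_right A i j _).symm ▸ zero_mem _
      · exact (L.ten_br_add_right A i j _ _ _).symm ▸ add_mem h h'
      · exact Submodule.subset_span ⟨_, _, mMul_comm A b a ▸ hmul k b a ha, rfl⟩
    · exact (L.ten_br_zero_left A i j _).symm ▸ zero_mem _
    · exact (L.ten_br_add_left A i j _ _ _).symm ▸ add_mem h h'
    · exact ((L.tensor A).br_smul_left i j c _ _).symm ▸ Submodule.smul_mem _ c h

variable (W : DGLA)

/-- The bracket in degrees `0` and `0`. -/
def b00 : W.V 0 →ₗ[ℂ] W.V 0 →ₗ[ℂ] W.V 0 := W.brLin 0 0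

/-- The bracket in degrees `0` and `1`. -/
def b01 : W.V 0 →ₗ[ℂ] W.V 1 →ₗ[ℂ] W.V 1 := W.brLin 0 1

/-- The bracket in degrees `-1` and `1`. -/
def bm1 : W.V (-1) →ₗ[ℂ] W.V 1 →ₗ[ℂ] W.V 0 := W.brLin (-1) 1

theorem br_one_zero (x : W.V 1) (a : W.V 0) :
    W.tr (show (1 : ℤ) + 0 = 1 by omega) (W.br 1 0 x a) = -W.b01 a x := by
  have := W.antisym 1 0 x a
  rw [show (Int.negOnePow (1 * 0) : ℤˣ) = 1 from by simp, Units.val_one, one_zsmul] at this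
  exact this

theorem br_one_one (x y : W.V 1) : W.br 1 1 x y = W.br 1 1 y x := by
  have := W.antisym 1 1 x y
  rw [show (Int.negOnePow (1 * 1) : ℤˣ) = -1 from by simp, Units.val_neg, Units.val_one, neg_smul,
    one_zsmul] at this
  exact this.trans (neg_neg _)

theorem br_one_neg_one {j : ℤ} (h : 1 + -1 = j) (y : W.V 1) (c : W.V (-1)) :
    W.tr h (W.br 1 (-1) y c) = W.tr (show 0 = j by omega) (W.bm1 c y) := by
  have := congrArg (W.tr h) (W.antisym 1 (-1) y c)
  rw [show (Int.negOnePow (1 * (-1)) : ℤˣ) = -1 from by simp, Units.val_neg, Units.val_one,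
    neg_smul, one_zsmul, W.tr_neg, W.tr_neg, W.tr_neg, neg_neg, W.tr_tr] at this
  exact this

theorem br_zero_zero (a b : W.V 0) : W.b00 a b = -W.b00 b a := by
  have := W.antisym 0 0 a b
  rw [show (Int.negOnePow (0 * 0) : ℤˣ) = 1 from by simp, Units.val_one, one_zsmul] at this
  exact this

/-- The degrees `-1, 0, 1, 2` of a nilpotently filtered differential graded Lie algebra. -/
def slice (hW : W.NilFiltered) : LieSlice (W.V (-1)) (W.V 0) (W.V 1) (W.V 2) where
  dm := W.dLin (-1)
  d₀ := W.dLin 0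
  d₁ := W.dLin 1
  b00 := W.b00
  b0m := W.brLin 0 (-1)
  b01 := W.b01
  b02 := W.brLin 0 2
  bm1 := W.bm1
  bm2 := W.brLin (-1) 2
  b11 := W.brLin 1 1
  isLie := ⟨W.br_zero_zero, fun a b c => by
    have := W.jacobi 0 0 0 a b c
    rw [show (Int.negOnePow (0 * 0) : ℤˣ) = 1 from by simp, Units.val_one, one_zsmul] at this
    exact eq_sub_of_add_eq this.symm⟩
  b01_br a b x := by
    have := W.jacobi 0 0 1 a b x
    rw [show (Int.negOnePow (0 * 0) : ℤˣ) = 1 from by simp, Units.val_one, one_zsmul] at this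
    exact eq_sub_of_add_eq this.symm
  bm1_br a r x := by
    have := W.jacobi 0 (-1) 1 a r x
    rw [show (Int.negOnePow (0 * (-1)) : ℤˣ) = 1 from by simp, Units.val_one, one_zsmul] at this
    exact eq_sub_of_add_eq this.symm
  b11_br a x y := by
    have := W.jacobi 0 1 1 a x y
    rw [show (Int.negOnePow (0 * 1) : ℤˣ) = 1 from by simp, Units.val_one, one_zsmul] at this
    exact eq_sub_of_add_eq this.symm
  b11_symm := W.br_one_one
  bm2_b11 c y := by
    have := W.jacobi (-1) 1 1 c y y
    rw [show (Int.negOnePow ((-1) * 1) : ℤˣ) = -1 from by simp, Units.val_neg, Units.val_one,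
      neg_smul, one_zsmul] at this
    have h : W.brLin (-1) 2 c (W.brLin 1 1 y y) =
      W.b01 (W.bm1 c y) y + -W.tr (show (1 : ℤ) + 0 = 1 by omega) (W.br 1 0 y (W.bm1 c y)) := this
    rw [h, W.br_one_zero, neg_neg, two_smul]
  d₀_br a b := by
    have := W.leibniz 0 0 a b
    rw [show (Int.negOnePow 0 : ℤˣ) = 1 from by simp, Units.val_one, one_zsmul] at this
    have h : W.dLin 0 (W.b00 a b) =
        W.tr (show (1 : ℤ) + 0 = 1 by omega) (W.br 1 0 (W.d 0 a) b) + W.b01 a (W.d 0 b) := this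
    rw [h, W.br_one_zero, neg_add_eq_sub]
    rfl
  dm_br a r := by
    have := W.leibniz 0 (-1) a r
    rw [show (Int.negOnePow 0 : ℤˣ) = 1 from by simp, Units.val_one, one_zsmul] at this
    have h : W.dLin (-1) (W.brLin 0 (-1) a r) = W.bm1 r (W.d 0 a) + W.b00 a (W.d (-1) r) :=
      this.trans (congrArg (fun z => z + W.tr _ (W.br 0 (-1 + 1) a (W.d (-1) r)))
        (W.br_one_neg_one _ (W.d 0 a) r))
    rw [h, add_comm]
    rfl
  d₀_bm1 c y := by
    have := W.leibniz (-1) 1 c y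
    rw [show (Int.negOnePow (-1) : ℤˣ) = -1 from by simp, Units.val_neg, Units.val_one,
      neg_smul, one_zsmul] at this
    exact this.trans (sub_eq_add_neg _ _).symm
  d₁_br a x := by
    have := W.leibniz 0 1 a x
    rw [show (Int.negOnePow 0 : ℤˣ) = 1 from by simp, Units.val_one, one_zsmul] at this
    have h : W.dLin 1 (W.b01 a x) = W.tr (show (1 : ℤ) + 1 = 2 by omega) (W.br 1 1 (W.d 0 a) x) +
        W.tr (show (0 : ℤ) + 2 = 2 by omega) (W.br 0 2 a (W.d 1 x)) := this
    rw [h, add_comm]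
    exact congrArg _ (W.br_one_one _ _)
  d₀_dm c := W.d_sq (-1) c
  d₁_d₀ a := W.d_sq 0 a
  nil := by
    obtain ⟨F, h1, h2, ⟨K, hK⟩, h3, h4⟩ := hW
    exact ⟨F (-1), F 0, F 1, ⟨h1 _, h1 _, h1 _⟩, ⟨h2 _, h2 _, h2 _⟩,
      ⟨K, fun n hn => ⟨hK _ n hn, hK _ n hn, hK _ n hn⟩⟩, h3 0 0, h3 0 (-1),
      fun i r => h4 0 (-1) i r, h3 0 1, h3 (-1) 1⟩

end DGLA

end SliceOfDGLA

section Comparison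

namespace DGLA

variable (W : DGLA)

/-- The differential in degree `0`. -/
def d₀ : W.V 0 →ₗ[ℂ] W.V 1 := W.dLin 0

/-- The differential in degree `-1`. -/
def dm : W.V (-1) →ₗ[ℂ] W.V 0 := W.dLin (-1)

theorem neg_eq_negOnePow_one_smul {X : Type*} [AddCommGroup X] (x : X) :
    -x = ((Int.negOnePow 1 : ℤˣ) : ℤ) • x := by
  simp

theorem eq_negOnePow_zero_smul {X : Type*} [AddCommGroup X] (x : X) :
    x = ((Int.negOnePow 0 : ℤˣ) : ℤ) • x := by
  simp

theorem nest_eq_nestWith (x y : W.V 0) (w : List Bool) :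
    W.nest x y w = nestWith (fun u v => W.b00 u v) x y w := by
  induction w with
  | nil => rfl
  | cons b w ih =>
    cases w with
    | nil => rfl
    | cons c w => exact congrArg (W.ad00 (if b then x else y)) ih

theorem bch_eq_slice (hW : W.NilFiltered) (a b : W.V 0) :
    W.bch a b = (W.slice hW).gd.bch a b :=
  finsum_congr fun P => congrArg (bchCoeff P • ·) (W.nest_eq_nestWith a b (bchWord P))

theorem stab_eq_slice (hW : W.NilFiltered) (y : W.V 1) (c : W.V (-1)) :
    W.tr (show (-1:ℤ)+1 = 0 by omega) (W.d (-1) c) +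
      W.tr (show (1:ℤ)+(-1) = 0 by omega) (W.br 1 (-1) y c) = (W.slice hW).stab y c :=
  congrArg (fun z => W.tr (show (-1:ℤ)+1 = 0 by omega) (W.d (-1) c) + z)
    (W.br_one_neg_one _ y c)

theorem tdt_d_one (u : W.tdt.V 1) : W.tdt.d 1 u =
    ((polyMap (W.dLin 1) u.1, polyMap W.d₀ u.2 - polyDeriv u.1) :
      (ℕ →₀ W.V 2) × (ℕ →₀ W.V 1)) := by
  rw [sub_eq_add_neg (polyMap W.d₀ u.2) (polyDeriv u.1),
    neg_eq_negOnePow_one_smul (polyDeriv u.1), ← polyMap_eq_sum, ← polyMap_eq_sum]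
  rfl

theorem tdt_d_zero (u : W.tdt.V 0) : W.tdt.d 0 u =
    ((polyMap W.d₀ u.1, polyMap W.dm u.2 + polyDeriv u.1) :
      (ℕ →₀ W.V 1) × (ℕ →₀ W.V 0)) := by
  rw [eq_negOnePow_zero_smul (polyDeriv _), ← polyMap_eq_sum, ← polyMap_eq_sum]
  rfl

theorem tdt_br_zero_one (p : W.tdt.V 0) (u : W.tdt.V 1) : W.tdt.br 0 1 p u =
    ((polyConv W.b01 p.1 u.1, polyConv W.b00 p.1 u.2 - polyConv W.bm1 p.2 u.1) :
      (ℕ →₀ W.V 1) × (ℕ →₀ W.V 0)) := by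
  rw [sub_eq_add_neg (polyConv W.b00 p.1 u.2) (polyConv W.bm1 p.2 u.1),
    neg_eq_negOnePow_one_smul (polyConv W.bm1 p.2 u.1)]
  rfl

/-- The bracket in degrees `1` and `0`. -/
def b10 : W.V 1 →ₗ[ℂ] W.V 0 →ₗ[ℂ] W.V 1 := W.brLin 1 0

theorem b10_apply (x : W.V 1) (a : W.V 0) : W.b10 x a = -W.b01 a x := W.br_one_zero x a

theorem tdt_br_one_one (u : W.tdt.V 1) : W.tdt.br 1 1 u u =
    ((polyConv (W.brLin 1 1) u.1 u.1, (2 : ℂ) • -polyConv W.b01 u.2 u.1) :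
      (ℕ →₀ W.V 2) × (ℕ →₀ W.V 1)) := by
  have h : -polyConv W.b01 u.2 u.1 = polyConv W.b10 u.1 u.2 := by
    rw [← polyConv_neg]
    exact polyConv_swap (fun a x => (W.b10_apply x a).symm) u.2 u.1
  rw [two_smul]
  nth_rewrite 1 [h]
  rw [neg_eq_negOnePow_one_smul]
  rfl

theorem tdt_MC1_iff (hW : W.NilFiltered) (u : W.tdt.V 1) :
    W.tdt.MC1 u ↔ (W.slice hW).FormMC u := by
  have h : W.tdt.d 1 u + (2 : ℂ)⁻¹ • W.tdt.br 1 1 u u =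
      ((polyMap (W.dLin 1) u.1 + (2 : ℂ)⁻¹ • polyConv (W.brLin 1 1) u.1 u.1,
        polyMap W.d₀ u.2 - polyDeriv u.1 + (2 : ℂ)⁻¹ • (2 : ℂ) • -polyConv W.b01 u.2 u.1) :
      (ℕ →₀ W.V 2) × (ℕ →₀ W.V 1)) := by
    rw [tdt_d_one, tdt_br_one_one]
    rfl
  rw [GLD.MC1, h]
  refine Prod.ext_iff.trans (and_congr Iff.rfl ?_)
  rw [inv_smul_smul₀ two_ne_zero]
  change _ = (0 : ℕ →₀ W.V 1) ↔ polyDeriv u.1 = polyMap W.d₀ u.2 - polyConv W.b01 u.2 u.1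
  rw [← sub_eq_add_neg, sub_right_comm, sub_eq_zero, eq_comm]

theorem tdt_gauge_eq_slice (hW : W.NilFiltered) (p : W.tdt.V 0) (u : W.tdt.V 1) :
    W.tdt.gauge p u = (W.slice hW).form.gauge p u := by
  have h1 : W.tdt.ad01 p = (W.slice hW).form.act p := funext (W.tdt_br_zero_one p)
  have h2 : W.tdt.tr (show (0 : ℤ) + 1 = 1 by omega) (W.tdt.d 0 p) = (W.slice hW).form.d p :=
    W.tdt_d_zero p
  rw [GLD.gauge, h1, h2]
  rfl

end DGLA

end Comparison

section Morphisms

variable {L M : DGLA} (h : GLDHom L.toGLD M.toGLD) (A : Type) [CommRing A] [Algebra ℂ A]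
  [IsLocalRing A]

theorem hTen_add (i : ℤ) (x y : (L.ten A).V i) :
    hTen L M h A i (x + y) = hTen L M h A i x + hTen L M h A i y :=
  map_add (LinearMap.rTensor (mA A) (h.lin i)) x y

theorem hTen_zero (i : ℤ) : hTen L M h A i 0 = 0 :=
  map_zero (LinearMap.rTensor (mA A) (h.lin i))

theorem hTen_tenMk {i : ℤ} (x : L.V i) (a : mA A) :
    hTen L M h A i (L.tenMk x a) = M.tenMk (h.f i x) a := rfl

theorem hTen_d (i : ℤ) (x : (L.ten A).V i) :
    hTen L M h A (i + 1) ((L.ten A).d i x) = (M.ten A).d i (hTen L M h A i x) := by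
  induction x using DGLA.ten_induction with
  | zero => rw [DGLA.ten_d_zero, hTen_zero, hTen_zero, DGLA.ten_d_zero]
  | add x y hx hy => rw [DGLA.ten_d_add, hTen_add, hTen_add, hx, hy, DGLA.ten_d_add]
  | tmul x a => rw [DGLA.ten_d_tmul, hTen_tenMk, hTen_tenMk, h.f_d, DGLA.ten_d_tmul]

theorem hTen_br (i j : ℤ) (x : (L.ten A).V i) (y : (L.ten A).V j) :
    hTen L M h A (i + j) ((L.ten A).br i j x y) =
      (M.ten A).br i j (hTen L M h A i x) (hTen L M h A j y) := by
  induction x using DGLA.ten_induction with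
  | zero => rw [DGLA.ten_br_zero_left, hTen_zero, hTen_zero, DGLA.ten_br_zero_left]
  | add x x' hx hx' => rw [DGLA.ten_br_add_left, hTen_add, hTen_add, hx, hx',
      DGLA.ten_br_add_left]
  | tmul x a =>
    induction y using DGLA.ten_induction with
    | zero => rw [DGLA.ten_br_zero_right, hTen_zero, hTen_zero, DGLA.ten_br_zero_right]
    | add y y' hy hy' => rw [DGLA.ten_br_add_right, hTen_add, hTen_add, hy, hy',
        DGLA.ten_br_add_right]
    | tmul y b => rw [DGLA.ten_br_tmul, hTen_tenMk, hTen_tenMk, hTen_tenMk, h.f_br,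
        DGLA.ten_br_tmul]

variable [IsArtinianRing A]

variable (L) in
/-- The degrees `-1, 0, 1, 2` of `L ⊗ m_A`. -/
abbrev tenSlice : LieSlice ((L.ten A).V (-1)) ((L.ten A).V 0) ((L.ten A).V 1) ((L.ten A).V 2) :=
  (L.tensor A).slice (L.nilFiltered_tensor A)

/-- The morphism of slices induced by `h ⊗ id`. -/
def tenSliceHom : SliceHom (tenSlice L A) (tenSlice M A) where
  f₀ := LinearMap.rTensor (mA A) (h.lin 0)
  f₁ := LinearMap.rTensor (mA A) (h.lin 1)
  map_b00 := hTen_br h A 0 0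
  map_b01 := hTen_br h A 0 1
  map_d₀ := hTen_d h A 0
  map_MC x hx := by
    have h1 := congrArg (hTen L M h A 2) hx
    have h2 : hTen L M h A 2 ((L.ten A).d 1 x + (2 : ℂ)⁻¹ • (L.ten A).br 1 1 x x) =
        (M.ten A).d 1 (hTen L M h A 1 x) +
          (2 : ℂ)⁻¹ • (M.ten A).br 1 1 (hTen L M h A 1 x) (hTen L M h A 1 x) := by
      rw [hTen_add]
      refine congrArg₂ (· + ·) (hTen_d h A 1 x) ?_
      exact (map_smul (LinearMap.rTensor (mA A) (h.lin 2)) _ _).trans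
        (congrArg _ (hTen_br h A 1 1 x x))
    exact h2.symm.trans (h1.trans (hTen_zero h A 2))

theorem tdtMap_hTen (u : (L.ten A).tdt.V 1) :
    GLD.tdtMap (hTen L M h A) 1 u = (tenSliceHom h A).form u :=
  Prod.ext (polyMap_eq_sum (tenSliceHom h A).f₁ u.1) (polyMap_eq_sum (tenSliceHom h A).f₀ u.2)

end Morphisms

section S18

variable (L M N : DGLA) (h : GLDHom L.toGLD M.toGLD) (g : GLDHom N.toGLD M.toGLD)
variable (A : Type) [CommRing A] [Algebra ℂ A] [IsLocalRing A] [IsArtinianRing A]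

theorem htpyRel_of_gaugeRel {w w' : TripleSp L M N A} (hw : w ∈ MCset L M N h g A)
    (H : gaugeRel L M N h g A w w') : htpyRel L M N h g A w w' := by
  obtain ⟨hx, hy, hp⟩ := hw
  obtain ⟨a, b, c, h1, h2, h3⟩ := H
  obtain ⟨l, n, m, hl, hn, hm, e1, e2, e3, e4, e5, e6⟩ := LieSlice.exists_homotopy
    (tenSliceHom h A) (tenSliceHom g A) hx hy hp a b c
  refine ⟨l, n, m, ((L.tensor A).tdt_MC1_iff (L.nilFiltered_tensor A) l).2 hl,
    ((N.tensor A).tdt_MC1_iff (N.nilFiltered_tensor A) n).2 hn, ?_, e1, e2, e3, e4.trans h1.symm,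
    e5.trans h2.symm, e6.trans (Eq.trans ?_ h3.symm)⟩
  · exact (tdtMap_hTen g A n).trans (hm.trans
      (((M.tensor A).tdt_gauge_eq_slice (M.nilFiltered_tensor A) m _).symm.trans
        (congrArg ((M.ten A).tdt.gauge m) (tdtMap_hTen h A l).symm)))
  · have hb := (M.tensor A).bch_eq_slice (M.nilFiltered_tensor A)
    have hs := (M.tensor A).stab_eq_slice (M.nilFiltered_tensor A) (gTen M N g A 1 w.2.1) c
    refine Eq.trans ?_ (hb _ _).symm
    refine congrArg _ (Eq.trans ?_ (hb _ _).symm)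
    exact congrArg₂ _ hs.symm (hb _ _).symm

theorem gaugeRel_of_htpyRel {w w' : TripleSp L M N A} (hw : w ∈ MCset L M N h g A)
    (H : htpyRel L M N h g A w w') : gaugeRel L M N h g A w w' := by
  obtain ⟨x, y, p⟩ := w
  obtain ⟨x', y', p'⟩ := w'
  obtain ⟨l, n, m, hl, hn, hm, e1, e2, e3, e4, e5, e6⟩ := H
  obtain ⟨hx, hy, hp⟩ := hw
  dsimp only at e1 e2 e3 e4 e5 e6 hp
  subst e1 e2 e3 e4 e5 e6
  have hm' : (tenSliceHom g A).form n = (tenSlice M A).form.gauge m ((tenSliceHom h A).form l) := by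
    rw [← tdtMap_hTen h]
    exact (tdtMap_hTen g A n).symm.trans (hm.trans
      ((M.tensor A).tdt_gauge_eq_slice (M.nilFiltered_tensor A) m _))
  obtain ⟨a, b, c, h1, h2, h3⟩ := LieSlice.exists_gauge_of_homotopy
    (tenSliceHom h A) (tenSliceHom g A)
    (((L.tensor A).tdt_MC1_iff (L.nilFiltered_tensor A) l).1 hl)
    (((N.tensor A).tdt_MC1_iff (N.nilFiltered_tensor A) n).1 hn) hm' hp
  refine ⟨a, b, c, h1, h2, h3.trans ?_⟩
  have hb := (M.tensor A).bch_eq_slice (M.nilFiltered_tensor A)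
  have hs := (M.tensor A).stab_eq_slice (M.nilFiltered_tensor A)
    (gTen M N g A 1 ((N.ten A).evalT 0 1 n)) c
  refine Eq.trans ?_ (hb _ _).symm
  refine congrArg _ (Eq.trans ?_ (hb _ _).symm)
  exact congrArg₂ _ hs.symm (hb _ _).symm

/-- Two elements of `MC_{(h,g)}(A)` are gauge equivalent if and only if they are homotopy
equivalent; consequently `Def^∞_{C_{(h,g)}}(A) = MC^∞/homotopy` is isomorphic to
`Def_{(h,g)}(A) = MC_{(h,g)}/∼`. -/
theorem statement18
    (hres : Function.Bijective (algebraMap ℂ (IsLocalRing.ResidueField A))) :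
    (∀ w ∈ MCset L M N h g A, ∀ w' ∈ MCset L M N h g A,
      (gaugeRel L M N h g A w w' ↔ htpyRel L M N h g A w w')) ∧
    Nonempty
      (Quot (fun w w' : {w : TripleSp L M N A // w ∈ MCset L M N h g A} =>
          htpyRel L M N h g A w.1 w'.1) ≃
        Quot (fun w w' : {w : TripleSp L M N A // w ∈ MCset L M N h g A} =>
          gaugeRel L M N h g A w.1 w'.1)) := by
  have key : ∀ w ∈ MCset L M N h g A, ∀ w' ∈ MCset L M N h g A,
      (gaugeRel L M N h g A w w' ↔ htpyRel L M N h g A w w') := fun w hw w' _ =>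
    ⟨htpyRel_of_gaugeRel L M N h g A hw, gaugeRel_of_htpyRel L M N h g A hw⟩
  exact ⟨key, ⟨Quot.congr (Equiv.refl _) fun w w' => (key w.1 w.2 w'.1 w'.2).symm⟩⟩

end S18
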